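/- arXiv:1705.04431 — 4 statements merged into one kernel-verified Lean document; each statement's English description precedes it below -/
import Mathlib

section
/- Let E be a real Banach space, let L : E → E be a bounded linear operator, and let 𝒮 : E → ℝ be a bounded linear functional satisfying 𝒮(Lφ) = 𝒮(φ) for all φ ∈ E. Assume there exist C₀ > 0 and θ ∈ (0,1) such that ‖Lⁿφ‖ ≤ C₀ θⁿ ‖φ‖ for every n ∈ ℕ and every φ ∈ E with 𝒮φ = 0. Let u ∈ E with 𝒮u = 1, and let ρ ∈ E satisfy Lρ = ρ and 𝒮ρ = 1. Then the operator K : E → E defined by Kφ = φ − Lφ + (𝒮φ)·u is a bijection with bounded inverse S, and S u = ρ. -/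
/-- If the powers of `L` decay geometrically along `φ`, the Neumann series of `φ` is summable. -/
theorem summable_pow_apply_of_norm_le {E : Type*} [NormedAddCommGroup E] [NormedSpace ℝ E]
    [CompleteSpace E] (L : E →L[ℝ] E) {C θ : ℝ} (hθ0 : 0 ≤ θ) (hθ1 : θ < 1) {φ : E}
    (h : ∀ n : ℕ, ‖(L ^ n) φ‖ ≤ C * θ ^ n) : Summable fun n : ℕ => (L ^ n) φ :=
  Summable.of_norm_bounded ((summable_geometric_of_lt_one hθ0 hθ1).mul_left C) h

/-- The sum of a convergent Neumann series solves `x - L x = φ`. -/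
theorem tsum_pow_apply_sub_map {E : Type*} [NormedAddCommGroup E] [NormedSpace ℝ E]
    (L : E →L[ℝ] E) {φ : E} (h : Summable fun n : ℕ => (L ^ n) φ) :
    ∑' n : ℕ, (L ^ n) φ - L (∑' n : ℕ, (L ^ n) φ) = φ := by
  have hL : L (∑' n : ℕ, (L ^ n) φ) = ∑' n : ℕ, (L ^ (n + 1)) φ := by
    rw [L.map_tsum h]
    simp only [pow_succ', mul_apply_eq_comp]
  rw [hL, h.tsum_eq_zero_add]
  simp

/-- A functional invariant under `L` is invariant under the powers of `L`. -/
theorem map_pow_apply_of_map_apply {E : Type*} [NormedAddCommGroup E] [NormedSpace ℝ E]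
    (L : E →L[ℝ] E) (𝒮 : E →L[ℝ] ℝ) (h : ∀ φ : E, 𝒮 (L φ) = 𝒮 φ) (n : ℕ) (φ : E) :
    𝒮 ((L ^ n) φ) = 𝒮 φ := by
  induction n with
  | zero => simp
  | succ n ih => rw [pow_succ', mul_apply_eq_comp, h, ih]

/-- Let `E` be a real Banach space, `L` a bounded linear operator on `E`,
`𝒮` a bounded linear functional with `𝒮 ∘ L = 𝒮`, which is exponentially contracting on
`ker 𝒮`. If `u ∈ E` has `𝒮 u = 1` and `ρ` is a fixed point of `L` with `𝒮 ρ = 1`, then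
`K φ = φ - L φ + (𝒮 φ) • u` is a bijection of `E` with a bounded inverse `S`, and `S u = ρ`. -/
theorem solution_operator_acim
    {E : Type*} [NormedAddCommGroup E] [NormedSpace ℝ E] [CompleteSpace E]
    (L : E →L[ℝ] E) (𝒮 : E →L[ℝ] ℝ)
    (h𝒮L : ∀ φ : E, 𝒮 (L φ) = 𝒮 φ)
    (C₀ θ : ℝ) (hC₀ : 0 < C₀) (hθ0 : 0 < θ) (hθ1 : θ < 1)
    (hdecay : ∀ (n : ℕ) (φ : E), 𝒮 φ = 0 → ‖(L ^ n) φ‖ ≤ C₀ * θ ^ n * ‖φ‖)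
    (u : E) (hu : 𝒮 u = 1)
    (ρ : E) (hρ : L ρ = ρ) (hρ𝒮 : 𝒮 ρ = 1) :
    Function.Bijective (fun φ : E => φ - L φ + 𝒮 φ • u) ∧
      ∃ S : E →L[ℝ] E,
        (∀ φ : E, S (φ - L φ + 𝒮 φ • u) = φ) ∧
        (∀ φ : E, S φ - L (S φ) + 𝒮 (S φ) • u = φ) ∧
        S u = ρ := by
  have hfix : ∀ φ : E, 𝒮 φ = 0 → L φ = φ → φ = 0 := by
    intro φ hφ hLφ
    have hpow : ∀ n : ℕ, (L ^ n) φ = φ := by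
      intro n
      induction n with
      | zero => simp
      | succ n ih => rw [pow_succ, mul_apply_eq_comp, hLφ, ih]
    have hsum : Summable fun n : ℕ => (L ^ n) φ :=
      summable_pow_apply_of_norm_le (C := C₀ * ‖φ‖) L hθ0.le hθ1 fun n =>
        (hdecay n φ hφ).trans_eq (by ring)
    simp only [hpow] at hsum
    exact tendsto_nhds_unique tendsto_const_nhds hsum.tendsto_atTop_zero
  let K : E →L[ℝ] E := ContinuousLinearMap.id ℝ E - L + 𝒮.smulRight u
  have hK : ∀ φ : E, K φ = φ - L φ + 𝒮 φ • u := fun φ => by simp [K]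
  have hinj : Function.Injective K := by
    refine (injective_iff_map_eq_zero K).2 fun φ hφ => ?_
    rw [hK] at hφ
    have hS : 𝒮 φ = 0 := by simpa [h𝒮L, hu] using congrArg 𝒮 hφ
    refine hfix φ hS ?_
    rw [hS, zero_smul, add_zero] at hφ
    exact (sub_eq_zero.1 hφ).symm
  have hsurj : Function.Surjective K := by
    intro ψ
    set ψ₀ : E := ψ - 𝒮 ψ • u with hψ₀
    have hSψ₀ : 𝒮 ψ₀ = 0 := by simp [hψ₀, hu]
    have hsum : Summable fun n : ℕ => (L ^ n) ψ₀ :=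
      summable_pow_apply_of_norm_le (C := C₀ * ‖ψ₀‖) L hθ0.le hθ1 fun n =>
        (hdecay n ψ₀ hSψ₀).trans_eq (by ring)
    have hSsum : 𝒮 (∑' n : ℕ, (L ^ n) ψ₀) = 0 := by
      rw [𝒮.map_tsum hsum]
      simp only [map_pow_apply_of_map_apply L 𝒮 h𝒮L, hSψ₀, tsum_zero]
    refine ⟨𝒮 ψ • ρ + ∑' n : ℕ, (L ^ n) ψ₀, ?_⟩
    rw [hK, map_add, map_add, map_smul, map_smul, hρ, hρ𝒮, hSsum, add_sub_add_left_eq_sub,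
      tsum_pow_apply_sub_map L hsum, hψ₀]
    simp
  have hKfun : (fun φ : E => φ - L φ + 𝒮 φ • u) = K := funext fun φ => (hK φ).symm
  let e : E ≃L[ℝ] E := ContinuousLinearEquiv.ofBijective K
    (LinearMap.ker_eq_bot.2 hinj) (LinearMap.range_eq_top.2 hsurj)
  have he : ∀ φ : E, e φ = φ - L φ + 𝒮 φ • u := hK
  have hleft : ∀ φ : E, e.symm (φ - L φ + 𝒮 φ • u) = φ := fun φ => by
    rw [← he, e.symm_apply_apply]
  refine ⟨hKfun ▸ ⟨hinj, hsurj⟩, e.symm, hleft, fun φ => ?_, ?_⟩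
  · exact (he _).symm.trans (e.apply_symm_apply φ)
  · simpa [hρ, hρ𝒮] using hleft ρ
end

section
/- Let β be a positive integer and δ > 0. Let v and h be holomorphic on the closed strip Λ_δ = {z ∈ ℂ : |Im z| ≤ δ}, with v real-valued on ℝ, v' (2πβ)-periodic, v(2πβ) − v(0) ∈ 2πℤ, and h (2πβ)-periodic. Suppose on Λ_δ that |h'(z)| ≤ H·|h(z)| and |v''(z)| ≤ Υ. Set μ₂ = min_{x∈ℝ} v'(x), μ₁ = max_{x∈ℝ} v'(x), and choose real numbers p₂ < μ₂ and p₁ > μ₁. Define ζ = min{ 2·min{μ₂ − p₂, p₁ − μ₁}/Υ, δ } (with ζ = δ if Υ = 0). Then ζ > 0 and for all j,k ∈ ℤ with j ∉ k·[p₂,p₁]: |M_{jk}| ≤ (‖h‖_{L¹[0,2πβ]} / 2π) · e^{ζ(H − d(j, k[p₂,p₁]))}, where M_{jk} = (1/2π) ∫₀^{2πβ} h(x) e^{i(k v(x) − j x)} dx and d(j, k[p₂,p₁]) := min_{t ∈ [p₂,p₁]} |j − k t|. -/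
/-- The open horizontal strip of half-width `δ` around the real axis. -/
def openStrip (δ : ℝ) : Set ℂ := {z : ℂ | |z.im| < δ}

theorem isOpen_openStrip (δ : ℝ) : IsOpen (openStrip δ) :=
  isOpen_lt (by fun_prop) continuous_const

theorem convex_openStrip (δ : ℝ) : Convex ℝ (openStrip δ) := by
  have h : openStrip δ = Complex.imLm ⁻¹' Set.Ioo (-δ) δ := by
    ext z
    simp [openStrip, abs_lt]
  rw [h]
  exact (convex_Ioo _ _).linear_preimage _

theorem add_mul_I_mem_openStrip {δ x y : ℝ} (hy : |y| < δ) :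
    (x + y * Complex.I : ℂ) ∈ openStrip δ := by
  simpa [openStrip] using hy

/-- The derivative of a function along a vertical line, traversed at speed `σ`. -/
theorem hasDerivAt_comp_vertical {f : ℂ → ℂ} {x σ s : ℝ}
    (hf : DifferentiableAt ℂ f (x + (σ * s : ℝ) * Complex.I)) :
    HasDerivAt (fun t : ℝ => f (x + (σ * t : ℝ) * Complex.I))
      (σ * Complex.I * deriv f (x + (σ * s : ℝ) * Complex.I)) s := by
  have h1 : HasDerivAt (fun t : ℝ => (x + (σ * t : ℝ) * Complex.I : ℂ)) (σ * Complex.I) s := by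
    have := ((((hasDerivAt_id s).const_mul σ).ofReal_comp).mul_const Complex.I).const_add (x : ℂ)
    simpa using this
  exact HasDerivAt.scomp s hf.hasDerivAt h1

theorem norm_sign_mul_I {σ : ℝ} (hσ : |σ| = 1) : ‖(σ * Complex.I : ℂ)‖ = 1 := by
  simpa using hσ

theorem abs_sign_mul {σ s : ℝ} (hσ : |σ| = 1) (hs : 0 ≤ s) : |σ * s| = s := by
  rw [abs_mul, hσ, one_mul, abs_of_nonneg hs]

/-- Grönwall's inequality along vertical lines: `‖f'‖ ≤ H ‖f‖` controls the growth of `f`. -/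
theorem norm_le_exp_mul_norm_of_norm_deriv_le {f : ℂ → ℂ} {δ H : ℝ}
    (hf : DifferentiableOn ℂ f (openStrip δ))
    (hH : ∀ z ∈ openStrip δ, ‖deriv f z‖ ≤ H * ‖f z‖)
    {σ η : ℝ} (hσ : |σ| = 1) (hη : 0 ≤ η) (hηδ : η < δ) (x : ℝ) :
    ‖f (x + (σ * η : ℝ) * Complex.I)‖ ≤ ‖f x‖ * Real.exp (H * η) := by
  have hmem : ∀ s ∈ Set.Icc 0 η, (x + (σ * s : ℝ) * Complex.I : ℂ) ∈ openStrip δ := fun s hs =>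
    add_mul_I_mem_openStrip (by rw [abs_sign_mul hσ hs.1]; exact hs.2.trans_lt hηδ)
  have hd : ∀ s ∈ Set.Icc 0 η, HasDerivAt (fun t : ℝ => f (x + (σ * t : ℝ) * Complex.I))
      (σ * Complex.I * deriv f (x + (σ * s : ℝ) * Complex.I)) s := fun s hs =>
    hasDerivAt_comp_vertical (hf.differentiableAt ((isOpen_openStrip δ).mem_nhds (hmem s hs)))
  have := norm_le_gronwallBound_of_norm_deriv_right_le (δ := ‖f x‖) (K := H) (ε := 0)
    (fun s hs => (hd s hs).continuousAt.continuousWithinAt)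
    (fun s hs => (hd s (Set.Ico_subset_Icc_self hs)).hasDerivWithinAt) (by simp)
    (fun s hs => by
      rw [norm_mul, norm_sign_mul_I hσ, one_mul, add_zero]
      exact hH _ (hmem s (Set.Ico_subset_Icc_self hs))) η ⟨hη, le_rfl⟩
  rwa [gronwallBound_ε0, sub_zero] at this

/-- Second-order Taylor estimate along vertical lines. -/
theorem norm_taylor_vertical_le {f : ℂ → ℂ} {δ C : ℝ}
    (hf : DifferentiableOn ℂ f (openStrip δ))
    (hC : ∀ z ∈ openStrip δ, ‖deriv (deriv f) z‖ ≤ C)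
    {σ η : ℝ} (hσ : |σ| = 1) (hη : 0 ≤ η) (hηδ : η < δ) (x : ℝ) :
    ‖f (x + (σ * η : ℝ) * Complex.I) - f x - (σ * η : ℝ) * Complex.I * deriv f x‖ ≤
      C * η ^ 2 / 2 := by
  have hmem : ∀ s ∈ Set.Icc 0 η, (x + (σ * s : ℝ) * Complex.I : ℂ) ∈ openStrip δ := fun s hs =>
    add_mul_I_mem_openStrip (by rw [abs_sign_mul hσ hs.1]; exact hs.2.trans_lt hηδ)
  have hx : (x : ℂ) ∈ openStrip δ := by simpa using hmem 0 ⟨le_rfl, hη⟩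
  have hd : ∀ s ∈ Set.Icc 0 η, HasDerivAt
      (fun t : ℝ => f (x + (σ * t : ℝ) * Complex.I) - f x - (σ * t : ℝ) * Complex.I * deriv f x)
      (σ * Complex.I * (deriv f (x + (σ * s : ℝ) * Complex.I) - deriv f x)) s := fun s hs => by
    have h1 := hasDerivAt_comp_vertical
      (hf.differentiableAt ((isOpen_openStrip δ).mem_nhds (hmem s hs)))
    have h2 := ((((hasDerivAt_id s).const_mul σ).ofReal_comp).mul_const Complex.I).mul_const
      (deriv f x)
    refine ((h1.sub_const (f x)).sub h2).congr_deriv ?_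
    push_cast
    ring
  have hB : ∀ s : ℝ, HasDerivAt (fun s : ℝ => C * s ^ 2 / 2) (C * s) s := fun s => by
    refine ((((hasDerivAt_id s).pow 2).const_mul C).div_const 2).congr_deriv ?_
    simp
    ring
  refine image_norm_le_of_norm_deriv_right_le_deriv_boundary
    (fun s hs => (hd s hs).continuousAt.continuousWithinAt)
    (fun s hs => (hd s (Set.Ico_subset_Icc_self hs)).hasDerivWithinAt) (by simp) hB
    (fun s hs => ?_) ⟨hη, le_rfl⟩
  have h3 := Convex.norm_image_sub_le_of_norm_deriv_le
    (fun z hz => (hf.deriv (isOpen_openStrip δ)).differentiableAt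
      ((isOpen_openStrip δ).mem_nhds hz)) hC (convex_openStrip δ) hx
    (hmem s (Set.Ico_subset_Icc_self hs))
  rw [norm_mul, norm_sign_mul_I hσ, one_mul]
  refine h3.trans_eq ?_
  rw [add_sub_cancel_left, norm_mul, Complex.norm_I, mul_one, Complex.norm_real, Real.norm_eq_abs,
    abs_sign_mul hσ hs.1]

/-- Functions holomorphic on a strip which agree on the real axis agree on the strip. -/
theorem eqOn_openStrip_of_eq_ofReal {f g : ℂ → ℂ} {δ : ℝ} (hδ : 0 < δ)
    (hf : DifferentiableOn ℂ f (openStrip δ)) (hg : DifferentiableOn ℂ g (openStrip δ))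
    (hfg : ∀ x : ℝ, f x = g x) : Set.EqOn f g (openStrip δ) := by
  refine (hf.analyticOnNhd (isOpen_openStrip δ)).eqOn_of_preconnected_of_frequently_eq
    (hg.analyticOnNhd (isOpen_openStrip δ)) (convex_openStrip δ).isPreconnected
    (z₀ := 0) (by simpa [openStrip] using hδ) ?_
  have ht : Filter.Tendsto (fun x : ℝ => (x : ℂ)) (nhdsWithin 0 {0}ᶜ) (nhdsWithin 0 {0}ᶜ) := by
    refine tendsto_nhdsWithin_iff.2 ⟨?_, ?_⟩
    · exact (Complex.continuous_ofReal.tendsto' 0 0 (by simp)).mono_left nhdsWithin_le_nhds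
    · filter_upwards [self_mem_nhdsWithin] with x hx
      simpa using hx
  exact ht.frequently (Filter.Eventually.of_forall hfg).frequently

/-- A real function whose derivative has period `L` changes by a constant over each period. -/
theorem add_period_sub_eq {v : ℝ → ℝ} {L : ℝ} (hv : Differentiable ℝ v)
    (hper : ∀ x, deriv v (x + L) = deriv v x) (x : ℝ) : v (x + L) - v x = v L - v 0 := by
  have hd : Differentiable ℝ (fun x => v (x + L) - v x) :=
    (hv.comp (differentiable_id.add_const L)).sub hv
  have := is_const_of_deriv_eq_zero hd (fun y => by
    have h1 : HasDerivAt (fun x => v (x + L)) (deriv v (y + L)) y :=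
      (hv (y + L)).hasDerivAt.comp_add_const y L
    exact (h1.sub (hv y).hasDerivAt).deriv.trans (by rw [hper, sub_self])) x 0
  simpa using this

/-- Contour shift for a periodic function holomorphic on a strip. -/
theorem integral_eq_integral_vertical_shift {f : ℂ → ℂ} {δ L : ℝ}
    (hf : DifferentiableOn ℂ f (openStrip δ)) (hper : ∀ z ∈ openStrip δ, f (z + L) = f z)
    {y : ℝ} (hy : |y| < δ) :
    ∫ x in (0 : ℝ)..L, f x = ∫ x in (0 : ℝ)..L, f (x + y * Complex.I) := by
  have hmem : ∀ s ∈ Set.uIcc 0 y, |s| < δ := fun s hs => by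
    have := Set.abs_sub_left_of_mem_uIcc hs
    simp only [sub_zero] at this
    exact this.trans_lt hy
  have h := Complex.integral_boundary_rect_eq_zero_of_differentiableOn f 0 (L + y * Complex.I)
    (hf.mono fun z hz => hmem z.im (by simpa using hz.2))
  have hside : ∫ s in (0 : ℝ)..y, f (L + s * Complex.I) = ∫ s in (0 : ℝ)..y, f (s * Complex.I) :=
    intervalIntegral.integral_congr fun s hs => by
      have := hper (s * Complex.I) (by simpa using add_mul_I_mem_openStrip (x := 0) (hmem s hs))
      simpa [add_comm] using this
  simp only [Complex.zero_re, Complex.zero_im, Complex.add_re, Complex.ofReal_re, Complex.mul_re,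
    Complex.I_re, Complex.ofReal_im, Complex.I_im, Complex.add_im, Complex.mul_im, mul_zero,
    zero_mul, mul_one, sub_zero, add_zero, zero_add, Complex.ofReal_zero] at h
  rw [hside, add_sub_cancel_right, sub_eq_zero] at h
  exact h

/-- A point off an order-connected set lies on one side of it, uniformly at the distance to it. -/
theorem exists_sign_infDist_le {S : Set ℝ} (hS : S.OrdConnected) {a : ℝ} (ha : a ∉ S) :
    ∃ σ : ℝ, |σ| = 1 ∧ ∀ y ∈ S, Metric.infDist a S ≤ σ * (y - a) := by
  by_cases h : ∃ y ∈ S, a < y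
  · obtain ⟨y₀, hy₀, hlt⟩ := h
    refine ⟨1, by simp, fun y hy => ?_⟩
    have hay : a ≤ y := by
      by_contra! hc
      exact ha (hS.out hy hy₀ ⟨hc.le, hlt.le⟩)
    refine (Metric.infDist_le_dist_of_mem hy).trans_eq ?_
    rw [Real.dist_eq, abs_sub_comm, abs_of_nonneg (sub_nonneg.2 hay), one_mul]
  · push Not at h
    refine ⟨-1, by simp, fun y hy => ?_⟩
    refine (Metric.infDist_le_dist_of_mem hy).trans_eq ?_
    rw [Real.dist_eq, abs_of_nonneg (sub_nonneg.2 (h y hy))]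
    ring

/-- Oscillatory integral bound for a contour shifted by `η` inside the open strip. -/
theorem norm_integral_mul_exp_le_of_shift
    {δ L H C μ₁ μ₂ p₁ p₂ : ℝ} (hL : 0 ≤ L)
    {v : ℝ → ℝ} {V h : ℂ → ℂ}
    (hV : DifferentiableOn ℂ V (openStrip δ)) (hh : DifferentiableOn ℂ h (openStrip δ))
    (hVv : ∀ x : ℝ, V x = (v x : ℂ))
    (hH : ∀ z ∈ openStrip δ, ‖deriv h z‖ ≤ H * ‖h z‖)
    (hC : ∀ z ∈ openStrip δ, ‖deriv (deriv V) z‖ ≤ C)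
    (hlb : ∀ x : ℝ, μ₂ ≤ (deriv V x).re) (hub : ∀ x : ℝ, (deriv V x).re ≤ μ₁)
    {j k : ℝ}
    (hper : ∀ z ∈ openStrip δ,
      h (z + L) * Complex.exp (Complex.I * (k * V (z + L) - j * (z + L))) =
        h z * Complex.exp (Complex.I * (k * V z - j * z)))
    (hjk : j ∉ (fun t => k * t) '' Set.Icc p₂ p₁)
    {η : ℝ} (hη : 0 < η) (hηδ : η < δ) (hη₂ : C * η / 2 ≤ μ₂ - p₂) (hη₁ : C * η / 2 ≤ p₁ - μ₁) :
    ‖∫ x in (0 : ℝ)..L, h x * Complex.exp (Complex.I * ((k * v x - j * x : ℝ) : ℂ))‖ ≤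
      (∫ x in (0 : ℝ)..L, ‖h x‖) *
        Real.exp (η * (H - Metric.infDist j ((fun t => k * t) '' Set.Icc p₂ p₁))) := by
  set S := (fun t => k * t) '' Set.Icc p₂ p₁ with hS
  have hconn : S.OrdConnected :=
    (isPreconnected_Icc.image _ (by fun_prop : Continuous fun t => k * t).continuousOn).ordConnected
  obtain ⟨σ, hσ, hdist⟩ := exists_sign_infDist_le hconn hjk
  have hση : |σ * η| < δ := by rwa [abs_sign_mul hσ hη.le]
  have hstrip : ∀ x : ℝ, (x : ℂ) ∈ openStrip δ := fun x => by
    simpa using add_mul_I_mem_openStrip (x := x) (y := 0) (by simpa using hη.trans hηδ)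
  set F : ℂ → ℂ := fun z => h z * Complex.exp (Complex.I * (k * V z - j * z)) with hF
  have hFd : DifferentiableOn ℂ F (openStrip δ) :=
    hh.mul (((hV.const_mul _).sub (differentiableOn_id.const_mul _)).const_mul _).cexp
  have hshift := integral_eq_integral_vertical_shift hFd hper hση
  have hint : ∫ x in (0 : ℝ)..L, h x * Complex.exp (Complex.I * ((k * v x - j * x : ℝ) : ℂ)) =
      ∫ x in (0 : ℝ)..L, F x := by
    simp only [hF, hVv]
    push_cast
    rfl
  have hcont : Continuous fun x : ℝ => ‖h x‖ :=
    (hh.continuousOn.comp_continuous Complex.continuous_ofReal hstrip).norm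
  rw [hint, hshift, ← intervalIntegral.integral_mul_const]
  refine intervalIntegral.norm_integral_le_of_norm_le hL (Filter.Eventually.of_forall fun x _ => ?_)
    ((hcont.mul continuous_const).intervalIntegrable _ _)
  have htaylor := norm_taylor_vertical_le hV hC hσ hη.le hηδ x
  have hgron := norm_le_exp_mul_norm_of_norm_deriv_le hh hH hσ hη.le hηδ x
  set w : ℂ := x + (σ * η : ℝ) * Complex.I with hw
  have him : |(V w).im - σ * η * (deriv V x).re| ≤ C * η ^ 2 / 2 := by
    refine le_trans (le_of_eq ?_) ((Complex.abs_im_le_norm _).trans htaylor)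
    simp [hVv]
  have hσ2 : σ * σ = 1 := by rw [← abs_mul_abs_self, hσ, one_mul]
  -- The mean slope of `Im V` over the vertical segment.
  set t : ℝ := σ * (V w).im / η with ht
  have htη : t * η = σ * (V w).im := by rw [ht]; field_simp
  have htd : |t - (deriv V x).re| ≤ C * η / 2 := by
    have h1 : |t - (deriv V x).re| * η = |(V w).im - σ * η * (deriv V x).re| := by
      have h2 : (t - (deriv V x).re) * η = σ * ((V w).im - σ * η * (deriv V x).re) := by
        linear_combination htη + (η * (deriv V x).re) * hσ2
      rw [← abs_of_pos hη, ← abs_mul, abs_of_pos hη, h2, abs_mul, hσ, one_mul]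
    refine le_of_mul_le_mul_right ?_ hη
    rw [h1]
    linarith
  have htmem : t ∈ Set.Icc p₂ p₁ := by
    have := abs_le.1 htd
    constructor <;> linarith [hlb x, hub x]
  have hdt := hdist (k * t) ⟨t, htmem, rfl⟩
  have hre : (Complex.I * (k * V w - j * w)).re = -(η * (σ * (k * t - j))) := by
    have : (Complex.I * (k * V w - j * w)).re = -(k * (V w).im - j * (σ * η)) := by
      simp [hw]
    rw [this]
    linear_combination (σ * k) * htη + (k * (V w).im) * hσ2
  rw [hF, norm_mul, Complex.norm_exp, hre]
  calc ‖h w‖ * Real.exp (-(η * (σ * (k * t - j))))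
      ≤ ‖h x‖ * Real.exp (H * η) * Real.exp (-(η * Metric.infDist j S)) := by gcongr
    _ = ‖h x‖ * Real.exp (η * (H - Metric.infDist j S)) := by
      rw [mul_assoc, ← Real.exp_add]
      ring_nf

/-- Exponential decay of the Fourier coefficient matrix of a generalized
transfer operator under the analytic distortion condition: `v` and `h` extend
holomorphically to the closed strip `|Im z| ≤ δ`, with `|h'| ≤ H |h|` and `|v''| ≤ Υ` there.
With `ζ = min(2 min(μ₂ - p₂, p₁ - μ₁)/Υ, δ)` (and `ζ = δ` if `Υ = 0`), we have `ζ > 0` and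
`|M_{jk}| ≤ (‖h‖₁/2π) e^{ζ(H - d(j, k[p₂,p₁]))}` whenever `j ∉ k·[p₂,p₁]`. -/
theorem oscillatory_entry_bound_analytic
    (β : ℕ) (hβ : 0 < β) (δ : ℝ) (hδ : 0 < δ)
    (v : ℝ → ℝ) (V h : ℂ → ℂ)
    (hVhol : DifferentiableOn ℂ V {z : ℂ | |z.im| ≤ δ})
    (hhhol : DifferentiableOn ℂ h {z : ℂ | |z.im| ≤ δ})
    (hVv : ∀ x : ℝ, V x = (v x : ℂ))
    (hvper : ∀ x : ℝ, deriv v (x + 2 * Real.pi * β) = deriv v x)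
    (hvlift : ∃ m : ℤ, v (2 * Real.pi * β) - v 0 = 2 * Real.pi * m)
    (hhper : ∀ z : ℂ, h (z + 2 * Real.pi * β) = h z)
    (H Υ : ℝ)
    (hH : ∀ z : ℂ, |z.im| ≤ δ → ‖deriv h z‖ ≤ H * ‖h z‖)
    (hΥ : ∀ z : ℂ, |z.im| ≤ δ → ‖deriv (deriv V) z‖ ≤ Υ)
    (μ₁ μ₂ p₁ p₂ : ℝ)
    (hlb : ∀ x : ℝ, μ₂ ≤ deriv v x) (hub : ∀ x : ℝ, deriv v x ≤ μ₁)
    (hμ₂ : ∃ x : ℝ, deriv v x = μ₂) (hμ₁ : ∃ x : ℝ, deriv v x = μ₁)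
    (hp₂ : p₂ < μ₂) (hp₁ : μ₁ < p₁) :
    0 < (if Υ = 0 then δ else min (2 * min (μ₂ - p₂) (p₁ - μ₁) / Υ) δ) ∧
      ∀ j k : ℤ,
        (j : ℝ) ∉ (fun t => (k : ℝ) * t) '' Set.Icc p₂ p₁ →
        ‖(1 / (2 * Real.pi) : ℂ) *
            ∫ x in (0 : ℝ)..(2 * Real.pi * β),
              h x * Complex.exp (Complex.I * ((↑k * v x - ↑j * x : ℝ) : ℂ))‖ ≤
          (∫ x in (0 : ℝ)..(2 * Real.pi * β), ‖h x‖) / (2 * Real.pi) *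
            Real.exp ((if Υ = 0 then δ else min (2 * min (μ₂ - p₂) (p₁ - μ₁) / Υ) δ) *
              (H - Metric.infDist (j : ℝ) ((fun t => (k : ℝ) * t) '' Set.Icc p₂ p₁))) := by
  set ζ : ℝ := if Υ = 0 then δ else min (2 * min (μ₂ - p₂) (p₁ - μ₁) / Υ) δ with hζ
  have hΥ0 : 0 ≤ Υ := (norm_nonneg _).trans (hΥ 0 (by simpa using hδ.le))
  have hmin : 0 < min (μ₂ - p₂) (p₁ - μ₁) := lt_min (sub_pos.2 hp₂) (sub_pos.2 hp₁)
  have hζpos : 0 < ζ := by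
    rw [hζ]
    split_ifs with h0
    · exact hδ
    · have := hΥ0.lt_of_ne' h0
      positivity
  have hζδ : ζ ≤ δ := by
    rw [hζ]
    split_ifs
    exacts [le_rfl, min_le_right _ _]
  have hζΥ : Υ * ζ / 2 ≤ min (μ₂ - p₂) (p₁ - μ₁) := by
    rw [hζ]
    split_ifs with h0
    · simpa [h0] using hmin.le
    · have hpos := hΥ0.lt_of_ne' h0
      have h1 := mul_le_mul_of_nonneg_left
        (min_le_left (2 * min (μ₂ - p₂) (p₁ - μ₁) / Υ) δ) hΥ0
      rw [mul_div_cancel₀ _ h0] at h1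
      linarith
  refine ⟨hζpos, fun j k hjk => ?_⟩
  have hsub : openStrip δ ⊆ {z : ℂ | |z.im| ≤ δ} := fun z (hz : |z.im| < δ) => hz.le
  have hV := hVhol.mono hsub
  have hvd : ∀ x : ℝ, HasDerivAt v (deriv V x).re x := fun x => by
    have hx : (x : ℂ) ∈ openStrip δ := by simpa [openStrip] using hδ
    have := (hV.differentiableAt ((isOpen_openStrip δ).mem_nhds hx)).hasDerivAt.real_of_complex
    simpa [hVv] using this
  set L : ℝ := 2 * Real.pi * β with hLdef
  have hL : 0 ≤ L := by positivity
  have hLc : ((2 * Real.pi * β : ℝ) : ℂ) = 2 * Real.pi * β := by push_cast; rfl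
  obtain ⟨m, hm⟩ := hvlift
  have htrans : Set.MapsTo (fun z : ℂ => z + L) (openStrip δ) (openStrip δ) := fun z hz => by
    simpa [openStrip] using hz
  have hVper : ∀ z ∈ openStrip δ, V (z + L) = V z + 2 * Real.pi * m := by
    refine eqOn_openStrip_of_eq_ofReal hδ
      (hV.comp (differentiableOn_id.add_const _) htrans) (hV.add_const _) fun x => ?_
    have := add_period_sub_eq (fun x => (hvd x).differentiableAt) hvper x
    rw [hm, sub_eq_iff_eq_add'] at this
    simp only [← Complex.ofReal_add, hVv, this]
    push_cast
    ring
  have hper : ∀ z ∈ openStrip δ,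
      h (z + L) * Complex.exp (Complex.I * ((k : ℝ) * V (z + L) - (j : ℝ) * (z + L))) =
        h z * Complex.exp (Complex.I * ((k : ℝ) * V z - (j : ℝ) * z)) := fun z hz => by
    have hhz : h (z + L) = h z := by rw [hLdef, hLc]; exact hhper z
    rw [hVper z hz, hhz]
    congr 1
    refine Complex.exp_eq_exp_iff_exists_int.2 ⟨k * m - j * β, ?_⟩
    rw [hLdef]
    push_cast
    ring
  have hbound : ∀ η ∈ Set.Ioo 0 ζ,
      ‖∫ x in (0 : ℝ)..L, h x * Complex.exp (Complex.I * ((k * v x - j * x : ℝ) : ℂ))‖ ≤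
        (∫ x in (0 : ℝ)..L, ‖h x‖) * Real.exp (η * (H - Metric.infDist (j : ℝ)
          ((fun t => (k : ℝ) * t) '' Set.Icc p₂ p₁))) := fun η hη => by
    have hηΥ : Υ * η / 2 ≤ min (μ₂ - p₂) (p₁ - μ₁) :=
      le_trans (by have := mul_le_mul_of_nonneg_left hη.2.le hΥ0; linarith) hζΥ
    exact norm_integral_mul_exp_le_of_shift hL hV (hhhol.mono hsub) hVv
      (fun z hz => hH z (hsub hz)) (fun z hz => hΥ z (hsub hz))
      (fun x => (hvd x).deriv ▸ hlb x) (fun x => (hvd x).deriv ▸ hub x) hper hjk hη.1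
      (hη.2.trans_le hζδ) (hηΥ.trans (min_le_left _ _)) (hηΥ.trans (min_le_right _ _))
  have hlim : ‖∫ x in (0 : ℝ)..L, h x * Complex.exp (Complex.I * ((k * v x - j * x : ℝ) : ℂ))‖ ≤
      (∫ x in (0 : ℝ)..L, ‖h x‖) * Real.exp (ζ * (H - Metric.infDist (j : ℝ)
        ((fun t => (k : ℝ) * t) '' Set.Icc p₂ p₁))) := by
    have hcont : Continuous fun η : ℝ => (∫ x in (0 : ℝ)..L, ‖h x‖) * Real.exp (η *
        (H - Metric.infDist (j : ℝ) ((fun t => (k : ℝ) * t) '' Set.Icc p₂ p₁))) := by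
      fun_prop
    refine ge_of_tendsto ((hcont.tendsto ζ).mono_left
      (nhdsWithin_le_nhds (s := Set.Iio ζ))) ?_
    filter_upwards [Ioo_mem_nhdsLT hζpos] with η hη using hbound η hη
  have hnorm : ‖(1 / (2 * Real.pi) : ℂ)‖ = 1 / (2 * Real.pi) := by
    have : (1 / (2 * Real.pi) : ℂ) = ((1 / (2 * Real.pi) : ℝ) : ℂ) := by push_cast; rfl
    rw [this, Complex.norm_real, Real.norm_of_nonneg (by positivity)]
  rw [norm_mul, hnorm]
  refine (mul_le_mul_of_nonneg_left hlim (by positivity)).trans_eq ?_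
  ring
end

section
/- Let r be a positive integer. Let I be a countable index set, let (O_ι)_{ι∈I} be pairwise disjoint nonempty open subintervals of (−1,1) with Σ_ι |O_ι| = 2, and for each ι ∈ I let v_ι : [−1,1] → [−1,1] be a C^{r+1} strictly monotone map with v_ι([−1,1]) equal to the closure of O_ι. Assume: (distortion) sup_{ι, x} |v_ι^{(n+1)}(x)/v_ι'(x)| ≤ C_n < ∞ for n = 1,…,r; (uniform C-expansion) there exists λ̌ > 1 with √(1−x²)·|v_ι'(x)| ≤ λ̌⁻¹·√(1−v_ι(x)²) for all ι and all x ∈ (−1,1); (partition spacing) there exists Ξ < ∞ such that |O_ι| ≤ Ξ·dist(σ, O_ι) whenever ι ∈ I, σ ∈ {−1,1} and σ is not in the closure of O_ι. For j,k ∈ ℕ define L_{jk} = ((2−δ_{j0})/π) Σ_{ι∈I} ∫_{−1}^{1} |v_ι'(x)| T_k(v_ι(x)) T_j(x) (1−x²)^{−1/2} dx. Then for every p ∈ (λ̌⁻¹, 1) there exists C > 0 such that whenever k = 0 or j/k > p: |L_{jk}| ≤ C (1 + (j − p k))^{−r}. -/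
/-- The `m`-th Chebyshev polynomial on `[-1,1]`: `T_m(x) = cos (m * arccos x)`. -/
noncomputable def chebT (m : ℕ) (x : ℝ) : ℝ := Real.cos (m * Real.arccos x)

open Set MeasureTheory

/-- A family of functions on `S` is `n` times continuously differentiable within `S`, with all
derivatives of order at most `n` bounded uniformly over the family. -/
def UniformlyCk {ι : Type} (S : Set ℝ) : ℕ → (ι → ℝ → ℝ) → Prop
  | 0, F => (∃ K, ∀ i, ∀ x ∈ S, |F i x| ≤ K) ∧ ∀ i, ContinuousOn (F i) S
  | n + 1, F => (∃ K, ∀ i, ∀ x ∈ S, |F i x| ≤ K) ∧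
      ∃ F' : ι → ℝ → ℝ, (∀ i, ∀ x ∈ S, HasDerivWithinAt (F i) (F' i x) S x) ∧ UniformlyCk S n F'

namespace UniformlyCk

variable {ι κ : Type} {S : Set ℝ} {n : ℕ} {F G D D' : ι → ℝ → ℝ} {δ : ℝ}

theorem bounded (h : UniformlyCk S n F) : ∃ K, ∀ i, ∀ x ∈ S, |F i x| ≤ K := by
  cases n <;> exact h.1

theorem continuousOn (h : UniformlyCk S n F) (i : ι) : ContinuousOn (F i) S := by
  cases n with
  | zero => exact h.2 i
  | succ n =>
    obtain ⟨-, F', hF, -⟩ := h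
    exact fun x hx => (hF i x hx).continuousWithinAt

theorem of_succ (h : UniformlyCk S (n + 1) F) : UniformlyCk S n F := by
  induction n generalizing F with
  | zero => exact ⟨h.bounded, h.continuousOn⟩
  | succ n ih =>
    obtain ⟨hb, F', hF, h'⟩ := h
    exact ⟨hb, F', hF, ih h'⟩

theorem comp_index (h : UniformlyCk S n F) (f : κ → ι) : UniformlyCk S n fun k => F (f k) := by
  induction n generalizing F with
  | zero => exact ⟨h.1.imp fun K hK k => hK (f k), fun k => h.2 (f k)⟩
  | succ n ih =>
    obtain ⟨⟨K, hK⟩, F', hF, h'⟩ := h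
    exact ⟨⟨K, fun k => hK (f k)⟩, fun k => F' (f k), fun k => hF (f k), ih h'⟩

theorem const {c : ι → ℝ} {K : ℝ} (hc : ∀ i, |c i| ≤ K) : UniformlyCk S n fun i _ => c i := by
  induction n generalizing c K with
  | zero => exact ⟨⟨K, fun i _ _ => hc i⟩, fun i => continuousOn_const⟩
  | succ n ih =>
    exact ⟨⟨K, fun i _ _ => hc i⟩, fun _ _ => 0, fun i x _ => hasDerivWithinAt_const _ _ _,
      ih (c := fun _ => 0) (K := 0) (by simp)⟩

theorem add (hF : UniformlyCk S n F) (hG : UniformlyCk S n G) :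
    UniformlyCk S n fun i x => F i x + G i x := by
  have hb : ∃ K, ∀ i, ∀ x ∈ S, |F i x + G i x| ≤ K := by
    obtain ⟨K, hK⟩ := hF.bounded
    obtain ⟨L, hL⟩ := hG.bounded
    exact ⟨K + L, fun i x hx => (abs_add_le _ _).trans (add_le_add (hK i x hx) (hL i x hx))⟩
  induction n generalizing F G with
  | zero => exact ⟨hb, fun i => (hF.2 i).add (hG.2 i)⟩
  | succ n ih =>
    obtain ⟨-, F', hF', h⟩ := hF
    obtain ⟨-, G', hG', h'⟩ := hG
    refine ⟨hb, fun i x => F' i x + G' i x, fun i x hx => (hF' i x hx).add (hG' i x hx),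
      ih h h' ?_⟩
    obtain ⟨K, hK⟩ := h.bounded
    obtain ⟨L, hL⟩ := h'.bounded
    exact ⟨K + L, fun i x hx => (abs_add_le _ _).trans (add_le_add (hK i x hx) (hL i x hx))⟩

theorem bounded_mul (hF : UniformlyCk S n F) (hG : UniformlyCk S n G) :
    ∃ K, ∀ i, ∀ x ∈ S, |F i x * G i x| ≤ K := by
  obtain ⟨K, hK⟩ := hF.bounded
  obtain ⟨L, hL⟩ := hG.bounded
  refine ⟨K * L, fun i x hx => ?_⟩
  rw [abs_mul]
  exact mul_le_mul (hK i x hx) (hL i x hx) (abs_nonneg _) ((abs_nonneg _).trans (hK i x hx))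

theorem mul (hF : UniformlyCk S n F) (hG : UniformlyCk S n G) :
    UniformlyCk S n fun i x => F i x * G i x := by
  induction n generalizing F G with
  | zero => exact ⟨bounded_mul hF hG, fun i => (hF.2 i).mul (hG.2 i)⟩
  | succ n ih =>
    have hb := bounded_mul hF hG
    have hF0 := hF.of_succ
    have hG0 := hG.of_succ
    obtain ⟨-, F', hF', h⟩ := hF
    obtain ⟨-, G', hG', h'⟩ := hG
    exact ⟨hb, fun i x => F' i x * G i x + F i x * G' i x,
      fun i x hx => (hF' i x hx).mul (hG' i x hx), (ih h hG0).add (ih hF0 h')⟩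

theorem const_mul {c : ι → ℝ} {K : ℝ} (hc : ∀ i, |c i| ≤ K) (hF : UniformlyCk S n F) :
    UniformlyCk S n fun i x => c i * F i x :=
  (const hc).mul hF

theorem inv_bounded (hδ : 0 < δ) (hD : ∀ i, ∀ x ∈ S, δ ≤ |D i x|) :
    ∃ K, ∀ i, ∀ x ∈ S, |(D i x)⁻¹| ≤ K :=
  ⟨δ⁻¹, fun i x hx => by rw [abs_inv]; exact inv_anti₀ hδ (hD i x hx)⟩

/-- Reciprocals are controlled by a lower bound and by the derivative alone. -/
theorem inv_of_deriv (hδ : 0 < δ) (hD : ∀ i, ∀ x ∈ S, δ ≤ |D i x|)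
    (hd : ∀ i, ∀ x ∈ S, HasDerivWithinAt (D i) (D' i x) S x) (h : UniformlyCk S n D') :
    UniformlyCk S (n + 1) fun i x => (D i x)⁻¹ := by
  have hne : ∀ i, ∀ x ∈ S, D i x ≠ 0 := fun i x hx => abs_pos.1 (hδ.trans_le (hD i x hx))
  have hder : ∀ i, ∀ x ∈ S, HasDerivWithinAt (fun x => (D i x)⁻¹)
      (-1 * (D' i x * ((D i x)⁻¹ * (D i x)⁻¹))) S x := fun i x hx => by
    refine ((hd i x hx).fun_inv (hne i x hx)).congr_deriv ?_
    have := hne i x hx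
    field_simp
  have key : UniformlyCk S n (fun i x => (D i x)⁻¹) := by
    induction n with
    | zero => exact ⟨inv_bounded hδ hD, fun i x hx => (hder i x hx).continuousWithinAt⟩
    | succ n ih =>
      exact ⟨inv_bounded hδ hD, _, hder, const_mul (c := fun _ => -1) (K := 1) (by simp)
        (h.of_succ.mul ((ih h.of_succ).mul (ih h.of_succ)))⟩
  exact ⟨inv_bounded hδ hD, _, hder, const_mul (c := fun _ => -1) (K := 1) (by simp)
        (h.mul (key.mul key))⟩

theorem inv (hδ : 0 < δ) (hD : ∀ i, ∀ x ∈ S, δ ≤ |D i x|) (h : UniformlyCk S n D) :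
    UniformlyCk S n fun i x => (D i x)⁻¹ := by
  cases n with
  | zero =>
    exact ⟨inv_bounded hδ hD, fun i => (h.2 i).inv₀ fun x hx =>
      abs_pos.1 (hδ.trans_le (hD i x hx))⟩
  | succ n =>
    obtain ⟨-, D', hd, h'⟩ := h
    exact inv_of_deriv hδ hD hd h'

theorem inv_sqrt_bounded (hδ : 0 < δ) (hD : ∀ i, ∀ x ∈ S, δ ≤ D i x) :
    ∃ K, ∀ i, ∀ x ∈ S, |(√(D i x))⁻¹| ≤ K :=
  inv_bounded (Real.sqrt_pos.2 hδ) fun i x hx =>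
    (Real.sqrt_le_sqrt (hD i x hx)).trans (le_abs_self _)

/-- Inverse square roots are controlled by a lower bound and by the derivative alone. -/
theorem inv_sqrt_of_deriv (hδ : 0 < δ) (hD : ∀ i, ∀ x ∈ S, δ ≤ D i x)
    (hd : ∀ i, ∀ x ∈ S, HasDerivWithinAt (D i) (D' i x) S x) (h : UniformlyCk S n D') :
    UniformlyCk S (n + 1) fun i x => (√(D i x))⁻¹ := by
  have hpos : ∀ i, ∀ x ∈ S, 0 < D i x := fun i x hx => hδ.trans_le (hD i x hx)
  have hder : ∀ i, ∀ x ∈ S, HasDerivWithinAt (fun x => (√(D i x))⁻¹)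
      (-(1 / 2) * (D' i x * ((D i x)⁻¹ * (√(D i x))⁻¹))) S x := fun i x hx => by
    have h0 := hpos i x hx
    have hs := Real.sqrt_pos.2 h0
    refine (((hd i x hx).sqrt h0.ne').fun_inv hs.ne').congr_deriv ?_
    rw [Real.sq_sqrt h0.le]
    field_simp
  have hinv := inv_of_deriv hδ (fun i x hx => (hD i x hx).trans (le_abs_self _)) hd h
  have hc : ∀ i : ι, |(fun _ : ι => (-(1 / 2) : ℝ)) i| ≤ 1 := fun _ => by norm_num [abs_le]
  have key : UniformlyCk S n (fun i x => (√(D i x))⁻¹) := by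
    induction n with
    | zero => exact ⟨inv_sqrt_bounded hδ hD, fun i x hx => (hder i x hx).continuousWithinAt⟩
    | succ n ih =>
      exact ⟨inv_sqrt_bounded hδ hD, _, hder, const_mul hc
        (h.of_succ.mul (hinv.of_succ.of_succ.mul (ih h.of_succ hinv.of_succ)))⟩
  exact ⟨inv_sqrt_bounded hδ hD, _, hder, const_mul hc (h.mul (hinv.of_succ.mul key))⟩

theorem inv_sqrt (hδ : 0 < δ) (hD : ∀ i, ∀ x ∈ S, δ ≤ D i x) (h : UniformlyCk S n D) :
    UniformlyCk S n fun i x => (√(D i x))⁻¹ := by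
  cases n with
  | zero =>
    exact ⟨inv_sqrt_bounded hδ hD, fun i => (h.2 i).sqrt.inv₀ fun x hx =>
      (Real.sqrt_pos.2 (hδ.trans_le (hD i x hx))).ne'⟩
  | succ n =>
    obtain ⟨-, D', hd, h'⟩ := h
    exact inv_sqrt_of_deriv hδ hD hd h'

theorem sin_affine (κ : ℝ) (β : ι → ℝ) : UniformlyCk S n fun i x => Real.sin (κ * x + β i) := by
  have hb : ∀ β : ι → ℝ, ∃ K, ∀ i, ∀ x ∈ S, |Real.sin (κ * x + β i)| ≤ K :=
    fun β => ⟨1, fun i x _ => Real.abs_sin_le_one _⟩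
  induction n generalizing β with
  | zero => exact ⟨hb β, fun i => by fun_prop⟩
  | succ n ih =>
    refine ⟨hb β, fun i x => κ * Real.sin (κ * x + (β i + Real.pi / 2)), fun i x _ => ?_,
      const_mul (c := fun _ => κ) (fun _ => le_rfl) (ih _)⟩
    have h := ((((hasDerivAt_id x).const_mul κ).add_const (β i)).sin).hasDerivWithinAt (s := S)
    refine h.congr_deriv ?_
    simp [← add_assoc, Real.sin_add_pi_div_two, mul_comm]

theorem comp_cos (h : UniformlyCk (Icc (-1) 1) n F) :
    UniformlyCk univ n fun i θ => F i (Real.cos θ) := by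
  have hm : ∀ θ, Real.cos θ ∈ Icc (-1 : ℝ) 1 := Real.cos_mem_Icc
  induction n generalizing F with
  | zero =>
    exact ⟨h.1.imp fun K hK i θ _ => hK i _ (hm θ),
      fun i => (h.2 i).comp Real.continuous_cos.continuousOn fun θ _ => hm θ⟩
  | succ n ih =>
    obtain ⟨⟨K, hK⟩, F', hF, h'⟩ := h
    refine ⟨⟨K, fun i θ _ => hK i _ (hm θ)⟩, fun i θ => -1 * (F' i (Real.cos θ) * Real.sin θ),
      fun i θ _ => ?_, const_mul (c := fun _ => -1) (K := 1) (by simp) ((ih h').mul ?_)⟩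
    · refine ((hF i _ (hm θ)).comp θ (Real.hasDerivAt_cos θ).hasDerivWithinAt
        (fun t _ => hm t)).congr_deriv ?_
      ring
    · simpa using sin_affine (ι := ι) (S := univ) (n := n) 1 fun _ => 0

end UniformlyCk

theorem segment_mem_Icc {e x t : ℝ} (he : e ∈ Icc (-1 : ℝ) 1) (hx : x ∈ Icc (-1 : ℝ) 1)
    (ht : t ∈ Icc (0 : ℝ) 1) : e + t * (x - e) ∈ Icc (-1 : ℝ) 1 := by
  have := (convex_Icc (-1 : ℝ) 1).add_smul_sub_mem he hx ht
  simpa using this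

/-- Differentiation of weighted averages along the segments that start at a fixed point. -/
theorem hasDerivWithinAt_average {f f' : ℝ → ℝ}
    (hf : ∀ x ∈ Icc (-1 : ℝ) 1, HasDerivWithinAt f (f' x) (Icc (-1) 1) x)
    (hf' : ContinuousOn f' (Icc (-1) 1)) {e : ℝ} (he : e ∈ Icc (-1 : ℝ) 1) (m : ℕ) {x : ℝ}
    (hx : x ∈ Icc (-1 : ℝ) 1) :
    HasDerivWithinAt (fun x => ∫ t in (0 : ℝ)..1, t ^ m * f (e + t * (x - e)))
      (∫ t in (0 : ℝ)..1, t ^ (m + 1) * f' (e + t * (x - e))) (Icc (-1) 1) x := by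
  have h11 : (-1 : ℝ) ≤ 1 := by norm_num
  obtain ⟨q, hqc, hq, K, hK⟩ : ∃ q : ℝ → ℝ, Continuous q ∧ (∀ x ∈ Icc (-1 : ℝ) 1, q x = f' x) ∧
      ∃ K, ∀ x, |q x| ≤ K := by
    refine ⟨IccExtend h11 ((Icc (-1) 1).domRestrict f'), hf'.domRestrict.Icc_extend',
      fun x hx => IccExtend_of_mem h11 _ hx, ?_⟩
    obtain ⟨K, hK⟩ := isCompact_Icc.exists_bound_of_continuousOn hf'
    exact ⟨K, fun x => hK _ (projIcc (-1) 1 h11 x).2⟩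
  set F : ℝ → ℝ := fun x => f (-1) + ∫ s in (-1 : ℝ)..x, q s with hF
  have hFd : ∀ x, HasDerivAt F (q x) x := fun x =>
    ((hqc.integral_hasStrictDerivAt (-1) x).hasDerivAt).const_add _
  have hFc : Continuous F := continuous_iff_continuousAt.2 fun x => (hFd x).continuousAt
  have hFf : ∀ x ∈ Icc (-1 : ℝ) 1, f x = F x := fun x hx => by
    have : ∫ s in (-1 : ℝ)..x, q s = f x - f (-1) := by
      refine intervalIntegral.integral_eq_sub_of_hasDerivAt_of_le hx.1
        (fun y hy => ((hf y ⟨hy.1, hy.2.trans hx.2⟩).continuousWithinAt).mono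
          (Icc_subset_Icc_right hx.2)) (fun y hy => ?_) (hqc.intervalIntegrable _ _)
      have hy' : y ∈ Ioo (-1 : ℝ) 1 := ⟨hy.1, hy.2.trans_le hx.2⟩
      rw [hq y (Ioo_subset_Icc_self hy')]
      exact (hf y (Ioo_subset_Icc_self hy')).hasDerivAt (Icc_mem_nhds hy'.1 hy'.2)
    simp [hF, this]
  have heq : ∀ y ∈ Icc (-1 : ℝ) 1, ∫ t in (0 : ℝ)..1, t ^ m * f (e + t * (y - e)) =
      ∫ t in (0 : ℝ)..1, t ^ m * F (e + t * (y - e)) := fun y hy => by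
    refine intervalIntegral.integral_congr fun t ht => ?_
    rw [uIcc_of_le zero_le_one] at ht
    simp only [hFf _ (segment_mem_Icc he hy ht)]
  have heq' : ∫ t in (0 : ℝ)..1, t ^ (m + 1) * f' (e + t * (x - e)) =
      ∫ t in (0 : ℝ)..1, t ^ (m + 1) * q (e + t * (x - e)) := by
    refine intervalIntegral.integral_congr fun t ht => ?_
    rw [uIcc_of_le zero_le_one] at ht
    simp only [hq _ (segment_mem_Icc he hx ht)]
  rw [heq']
  refine HasDerivWithinAt.congr ?_ heq (heq x hx)
  refine HasDerivAt.hasDerivWithinAt ?_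
  refine (intervalIntegral.hasDerivAt_integral_of_dominated_loc_of_deriv_le (bound := fun _ => K)
    (F := fun x t => t ^ m * F (e + t * (x - e)))
    (F' := fun x t => t ^ (m + 1) * q (e + t * (x - e)))
    Filter.univ_mem ?_ ?_ ?_ ?_ ?_ ?_).2
  · refine Filter.Eventually.of_forall fun y => Continuous.aestronglyMeasurable ?_
    fun_prop
  · exact Continuous.intervalIntegrable (by fun_prop) _ _
  · exact Continuous.aestronglyMeasurable (by fun_prop)
  · refine Filter.Eventually.of_forall fun t ht y _ => ?_
    rw [uIoc_of_le zero_le_one] at ht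
    rw [norm_mul, Real.norm_eq_abs, Real.norm_eq_abs, abs_pow, abs_of_pos ht.1]
    calc t ^ (m + 1) * |q (e + t * (y - e))| ≤ 1 * |q (e + t * (y - e))| :=
          mul_le_mul_of_nonneg_right (pow_le_one₀ ht.1.le ht.2) (abs_nonneg _)
      _ ≤ K := by rw [one_mul]; exact hK _
  · exact intervalIntegrable_const
  · refine Filter.Eventually.of_forall fun t _ y _ => ?_
    have h1 : HasDerivAt (fun y => e + t * (y - e)) (t * 1) y :=
      (((hasDerivAt_id y).sub_const e).const_mul t).const_add e
    refine (((hFd _).comp y h1).const_mul (t ^ m)).congr_deriv ?_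
    ring

theorem UniformlyCk.average {ι : Type} {n : ℕ} {F : ι → ℝ → ℝ}
    (h : UniformlyCk (Icc (-1) 1) n F) {e : ι → ℝ} (he : ∀ i, e i ∈ Icc (-1 : ℝ) 1) (m : ℕ) :
    UniformlyCk (Icc (-1) 1) n
      fun i x => ∫ t in (0 : ℝ)..1, t ^ m * F i (e i + t * (x - e i)) := by
  have hb : ∀ (m : ℕ) {F : ι → ℝ → ℝ} {n : ℕ}, UniformlyCk (Icc (-1) 1) n F →
      ∃ K, ∀ i, ∀ x ∈ Icc (-1 : ℝ) 1,
        |∫ t in (0 : ℝ)..1, t ^ m * F i (e i + t * (x - e i))| ≤ K := by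
    intro m F n h
    obtain ⟨K, hK⟩ := h.bounded
    refine ⟨K, fun i x hx => ?_⟩
    have := intervalIntegral.norm_integral_le_of_norm_le_const (a := 0) (b := 1) (C := K)
      (f := fun t => t ^ m * F i (e i + t * (x - e i))) fun t ht => ?_
    · simpa using this
    · rw [uIoc_of_le zero_le_one] at ht
      rw [norm_mul, Real.norm_eq_abs, Real.norm_eq_abs, abs_pow, abs_of_pos ht.1]
      have := hK i _ (segment_mem_Icc (he i) hx ⟨ht.1.le, ht.2⟩)
      exact (mul_le_of_le_one_left (abs_nonneg _) (pow_le_one₀ ht.1.le ht.2)).trans this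
  induction n generalizing F m with
  | zero =>
    refine ⟨hb m h, fun i => ?_⟩
    have h11 : (-1 : ℝ) ≤ 1 := by norm_num
    have hq : Continuous (IccExtend h11 ((Icc (-1) 1).domRestrict (F i))) :=
      (h.2 i).domRestrict.Icc_extend'
    have hc : Continuous fun x => ∫ t in (0 : ℝ)..1,
        t ^ m * IccExtend h11 ((Icc (-1) 1).domRestrict (F i)) (e i + t * (x - e i)) :=
      intervalIntegral.continuous_parametric_intervalIntegral_of_continuous' (by fun_prop) _ _
    refine hc.continuousOn.congr fun x hx => intervalIntegral.integral_congr fun t ht => ?_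
    rw [uIcc_of_le zero_le_one] at ht
    simp only [IccExtend_of_mem h11 _ (segment_mem_Icc (he i) hx ht), domRestrict_apply]
  | succ n ih =>
    have hb' := hb m h
    obtain ⟨-, F', hF, h'⟩ := h
    exact ⟨hb', _, fun i x hx => hasDerivWithinAt_average (hF i) (h'.continuousOn i) (he i) m hx,
      ih h' (m + 1)⟩

open Real in
/-- Repeated integration by parts against a non-stationary phase. -/
theorem UniformlyCk.integral_cos_le {ι : Type} {r : ℕ} {A ρ ψ φ : ι → ℝ → ℝ} {m : ι → ℝ}
    (hm : ∀ i, 0 < m i) (hA : UniformlyCk univ r A) (hρ : UniformlyCk univ r ρ)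
    (hψ : ∀ i x, ρ i x * ψ i x = 1) (hψc : ∀ i, Continuous (ψ i))
    (hφ : ∀ i x, HasDerivAt (φ i) (m i * ψ i x) x)
    (hAp : ∀ i, Function.Periodic (A i) (4 * π)) (hρp : ∀ i, Function.Periodic (ρ i) (4 * π))
    (hφp : ∀ i, ∃ n : ℤ, φ i (2 * π) = φ i (-(2 * π)) + n * (2 * π)) :
    ∃ K, ∀ i, m i ^ r * |∫ x in (-(2 * π))..(2 * π), A i x * cos (φ i x)| ≤ K := by
  induction r generalizing A φ with
  | zero =>
    obtain ⟨K, hK⟩ := hA.bounded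
    refine ⟨K * |2 * π - -(2 * π)|, fun i => ?_⟩
    rw [pow_zero, one_mul]
    refine intervalIntegral.norm_integral_le_of_norm_le_const (E := ℝ)
      (f := fun x => A i x * cos (φ i x)) fun x _ => ?_
    rw [norm_mul]
    exact (mul_le_of_le_one_right (norm_nonneg _) (abs_cos_le_one _)).trans (hK i x trivial)
  | succ r ih =>
    obtain ⟨-, B, hB, hB'⟩ := hA.mul hρ
    have hBd : ∀ i x, HasDerivAt (fun x => A i x * ρ i x) (B i x) x := fun i x => by
      simpa using hB i x trivial
    have hBp : ∀ i, Function.Periodic (B i) (4 * π) := fun i x => by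
      have h1 := (hBd i (x + 4 * π)).comp_add_const x (4 * π)
      simp only [hAp i _, hρp i _] at h1
      exact h1.unique (hBd i x)
    have hBc : ∀ i, Continuous (B i) := fun i => continuousOn_univ.1 (hB'.continuousOn i)
    have hφc : ∀ i, Continuous (φ i) := fun i =>
      continuous_iff_continuousAt.2 fun x => (hφ i x).continuousAt
    obtain ⟨K, hK⟩ := ih (A := B) (φ := fun i x => φ i x - π / 2) hB' hρ.of_succ
      (fun i x => (hφ i x).sub_const _) hBp
      (fun i => (hφp i).imp fun n hn => by rw [hn]; ring)
    refine ⟨K, fun i => ?_⟩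
    have hparts := intervalIntegral.integral_mul_deriv_eq_deriv_mul
      (a := -(2 * π)) (b := 2 * π) (u := fun x => A i x * ρ i x) (u' := B i)
      (v := fun x => sin (φ i x)) (v' := fun x => cos (φ i x) * (m i * ψ i x))
      (fun x _ => hBd i x) (fun x _ => (hφ i x).sin) ((hBc i).intervalIntegrable _ _)
      (Continuous.intervalIntegrable (by have := hψc i; have := hφc i; fun_prop) _ _)
    have hper : ∀ {f : ℝ → ℝ}, Function.Periodic f (4 * π) → f (2 * π) = f (-(2 * π)) :=
      fun {f} hf => by rw [← hf (-(2 * π))]; ring_nf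
    obtain ⟨n, hn⟩ := hφp i
    simp only [hper (hAp i), hper (hρp i), hn, sin_add_int_mul_two_pi, sub_self, zero_sub]
      at hparts
    have e1 : ∫ x in (-(2 * π))..(2 * π), A i x * ρ i x * (cos (φ i x) * (m i * ψ i x)) =
        m i * ∫ x in (-(2 * π))..(2 * π), A i x * cos (φ i x) := by
      rw [← intervalIntegral.integral_const_mul]
      refine intervalIntegral.integral_congr fun x _ => ?_
      linear_combination (m i * A i x * cos (φ i x)) * hψ i x
    have e2 : ∫ x in (-(2 * π))..(2 * π), B i x * cos (φ i x - π / 2) =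
        ∫ x in (-(2 * π))..(2 * π), B i x * sin (φ i x) := by
      simp only [cos_sub_pi_div_two]
    have := hK i
    rw [e2] at this
    rw [e1] at hparts
    rwa [pow_succ, mul_assoc, ← abs_of_pos (hm i), ← abs_mul, abs_of_pos (hm i), hparts, abs_neg]

open Real in
/-- Uniform decay of oscillatory integrals whose phase derivative `s * k * γ + j` is bounded away
from zero relatively to `j + k`. -/
theorem UniformlyCk.integral_cos_phase_le {ι : Type} {r : ℕ} {A γ g : ι → ℝ → ℝ} {μ p s : ℝ}
    (hs : |s| ≤ 1) (hμ : 0 < μ) (hμp : μ < p)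
    (hA : UniformlyCk univ r A) (hγ : UniformlyCk univ r γ)
    (hg : ∀ i x, HasDerivAt (g i) (γ i x) x) (hγμ : ∀ i x, |γ i x| ≤ μ)
    (hAp : ∀ i, Function.Periodic (A i) (4 * π)) (hgp : ∀ i, Function.Periodic (g i) (4 * π)) :
    ∃ K, ∀ i, ∀ j k : ℕ, p * k < j → ((j : ℝ) + k) ^ r *
      |∫ x in (-(2 * π))..(2 * π), A i x * cos (s * (k * g i x) + j * x)| ≤ K := by
  have hp : 0 < p := hμ.trans hμp
  let J := ι × {q : ℕ × ℕ // p * (q.2 : ℝ) < q.1}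
  let j : J → ℝ := fun i => (i.2.1.1 : ℕ)
  let k : J → ℝ := fun i => (i.2.1.2 : ℕ)
  have hk : ∀ i, 0 ≤ k i := fun i => Nat.cast_nonneg _
  have hjk : ∀ i, p * k i < j i := fun i => i.2.2
  have hj : ∀ i, 0 < j i := fun i => (mul_nonneg hp.le (hk i)).trans_lt (hjk i)
  have hm : ∀ i, 0 < j i + k i := fun i => add_pos_of_pos_of_nonneg (hj i) (hk i)
  let ψ : J → ℝ → ℝ := fun i x =>
    (s * k i / (j i + k i)) * γ i.1 x + j i / (j i + k i)
  have hψ : UniformlyCk univ r ψ := by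
    refine UniformlyCk.add (UniformlyCk.const_mul (K := 1) (fun i => ?_) (hγ.comp_index Prod.fst))
      (UniformlyCk.const (K := 1) fun i => ?_)
    · rw [abs_div, abs_mul, abs_of_pos (hm i), abs_of_nonneg (hk i), div_le_one (hm i)]
      nlinarith [hk i, hj i]
    · rw [abs_div, abs_of_pos (hm i), abs_of_pos (hj i), div_le_one (hm i)]
      linarith [hk i]
  have hδ : 0 < (p - μ) / (p + 1) := div_pos (sub_pos.2 hμp) (by linarith)
  have hψl : ∀ i x, (p - μ) / (p + 1) ≤ ψ i x := fun i x => by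
    have h1 : |s * k i * γ i.1 x| ≤ k i * μ := by
      rw [abs_mul, abs_mul, abs_of_nonneg (hk i)]
      have := hγμ i.1 x
      exact mul_le_mul (mul_le_of_le_one_left (hk i) hs) this (abs_nonneg _) (hk i)
    have h2 : ψ i x = (s * k i * γ i.1 x + j i) / (j i + k i) := by
      simp only [ψ]; ring
    rw [h2, div_le_div_iff₀ (by linarith) (hm i)]
    have h3 := neg_abs_le (s * k i * γ i.1 x)
    nlinarith [hjk i, hk i, hj i]
  have hψ0 : ∀ i x, ψ i x ≠ 0 := fun i x => (hδ.trans_le (hψl i x)).ne'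
  have hγp : ∀ i, Function.Periodic (γ i) (4 * π) := fun i x => by
    have h1 := (hg i (x + 4 * π)).comp_add_const x (4 * π)
    simp only [hgp i _] at h1
    exact h1.unique (hg i x)
  have hφ : ∀ i x, HasDerivAt (fun x => s * (k i * g i.1 x) + j i * x)
      ((j i + k i) * ψ i x) x := fun i x => by
    refine ((((hg i.1 x).const_mul (k i)).const_mul s).add
      ((hasDerivAt_id x).const_mul (j i))).congr_deriv ?_
    have := (hm i).ne'
    simp only [ψ]
    field_simp
  have hφp : ∀ i : J, ∃ n : ℤ, s * (k i * g i.1 (2 * π)) + j i * (2 * π) =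
      s * (k i * g i.1 (-(2 * π))) + j i * (-(2 * π)) + n * (2 * π) := fun i => by
    refine ⟨2 * (i.2.1.1 : ℤ), ?_⟩
    have : g i.1 (2 * π) = g i.1 (-(2 * π)) := by rw [← hgp i.1 (-(2 * π))]; ring_nf
    rw [this]
    simp only [j]
    push_cast
    ring
  obtain ⟨K, hK⟩ := UniformlyCk.integral_cos_le (ι := J) (r := r) (A := fun i => A i.1)
    (ρ := fun i x => (ψ i x)⁻¹) (ψ := ψ) hm (hA.comp_index Prod.fst)
    (UniformlyCk.inv hδ (fun i x _ => (hψl i x).trans (le_abs_self _)) hψ)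
    (fun i x => inv_mul_cancel₀ (hψ0 i x)) (fun i => continuousOn_univ.1 (hψ.continuousOn i))
    hφ (fun i => hAp i.1) (fun i x => by simp only [ψ, hγp i.1 x]) hφp
  exact ⟨K, fun i j k h => hK (i, ⟨(j, k), h⟩)⟩

open Real in
theorem UniformlyCk.integral_cos_mul_cos_le {ι : Type} {r : ℕ} {A γ g : ι → ℝ → ℝ} {μ p : ℝ}
    (hμ : 0 < μ) (hμp : μ < p) (hA : UniformlyCk univ r A) (hγ : UniformlyCk univ r γ)
    (hg : ∀ i x, HasDerivAt (g i) (γ i x) x) (hγμ : ∀ i x, |γ i x| ≤ μ)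
    (hAp : ∀ i, Function.Periodic (A i) (4 * π)) (hgp : ∀ i, Function.Periodic (g i) (4 * π)) :
    ∃ K, ∀ i, ∀ j k : ℕ, p * k < j → ((j : ℝ) + k) ^ r *
      |∫ x in (-(2 * π))..(2 * π), A i x * (cos (k * g i x) * cos (j * x))| ≤ K := by
  obtain ⟨K, hK⟩ := UniformlyCk.integral_cos_phase_le (s := 1) (by simp) hμ hμp hA hγ hg hγμ hAp hgp
  obtain ⟨L, hL⟩ := UniformlyCk.integral_cos_phase_le (s := -1) (by simp) hμ hμp hA hγ hg hγμ hAp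
    hgp
  refine ⟨(K + L) / 2, fun i j k h => ?_⟩
  have hAc : Continuous (A i) := continuousOn_univ.1 (hA.continuousOn i)
  have hgc : Continuous (g i) := continuous_iff_continuousAt.2 fun x => (hg i x).continuousAt
  have e : ∫ x in (-(2 * π))..(2 * π), A i x * (cos (k * g i x) * cos (j * x)) =
      ((∫ x in (-(2 * π))..(2 * π), A i x * cos (1 * (k * g i x) + j * x)) +
        ∫ x in (-(2 * π))..(2 * π), A i x * cos (-1 * (k * g i x) + j * x)) / 2 := by
    rw [← intervalIntegral.integral_add, ← intervalIntegral.integral_div]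
    · refine intervalIntegral.integral_congr fun x _ => ?_
      simp only [one_mul, neg_mul, cos_add, cos_neg, sin_neg]
      ring
    · exact Continuous.intervalIntegrable (by fun_prop) _ _
    · exact Continuous.intervalIntegrable (by fun_prop) _ _
  rw [e, abs_div, abs_of_pos (two_pos (α := ℝ)), ← mul_div_assoc]
  refine div_le_div_of_nonneg_right ?_ two_pos.le
  refine (mul_le_mul_of_nonneg_left (abs_add_le _ _) (by positivity)).trans ?_
  rw [mul_add]
  exact add_le_add (hK i j k h) (hL i j k h)

open Real in
theorem integral_div_sqrt_one_sub_sq (G : ℝ → ℝ) :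
    ∫ x in (-1 : ℝ)..1, G x / √(1 - x ^ 2) = ∫ θ in (0 : ℝ)..π, G (cos θ) := by
  have himg : cos '' Ioo 0 π = Ioo (-1) 1 := by
    ext y
    constructor
    · rintro ⟨θ, hθ, rfl⟩
      have h1 := strictAntiOn_cos (left_mem_Icc.2 pi_pos.le) (Ioo_subset_Icc_self hθ) hθ.1
      have h2 := strictAntiOn_cos (Ioo_subset_Icc_self hθ) (right_mem_Icc.2 pi_pos.le) hθ.2
      rw [cos_zero] at h1
      rw [cos_pi] at h2
      exact ⟨h2, h1⟩
    · intro hy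
      exact ⟨arccos y, ⟨arccos_pos.2 hy.2, arccos_lt_pi.2 hy.1⟩, cos_arccos hy.1.le hy.2.le⟩
  rw [intervalIntegral.integral_of_le (by norm_num), intervalIntegral.integral_of_le pi_pos.le,
    integral_Ioc_eq_integral_Ioo, integral_Ioc_eq_integral_Ioo, ← himg,
    integral_image_eq_integral_abs_deriv_smul measurableSet_Ioo
      (fun θ _ => (hasDerivAt_cos θ).hasDerivWithinAt) (injOn_cos.mono Ioo_subset_Icc_self)]
  refine setIntegral_congr_fun measurableSet_Ioo fun θ hθ => ?_
  have hs := sin_pos_of_pos_of_lt_pi hθ.1 hθ.2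
  have : √(1 - cos θ ^ 2) = sin θ := by
    rw [← sin_sq, sqrt_sq hs.le]
  simp only [smul_eq_mul]
  rw [this, abs_neg, abs_of_pos hs]
  field_simp

open Real in
theorem integral_comp_cos_eq {G : ℝ → ℝ} (hG : ContinuousOn G (Icc (-1) 1)) :
    ∫ θ in (-(2 * π))..(2 * π), G (cos θ) = 4 * ∫ θ in (0 : ℝ)..π, G (cos θ) := by
  have hc : Continuous fun θ => G (cos θ) :=
    continuousOn_univ.1 (hG.comp continuous_cos.continuousOn fun θ _ => cos_mem_Icc θ)
  have hi : ∀ a b, IntervalIntegrable (fun θ => G (cos θ)) volume a b :=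
    fun a b => hc.intervalIntegrable a b
  have hp : Function.Periodic (fun θ => G (cos θ)) (2 * π) := fun θ => by simp
  have h1 := hp.intervalIntegral_add_eq (-(2 * π)) (-π)
  have h2 := hp.intervalIntegral_add_eq 0 (-π)
  have h3 : ∫ θ in (-π)..0, G (cos θ) = ∫ θ in (0 : ℝ)..π, G (cos θ) := by
    have := intervalIntegral.integral_comp_neg (a := 0) (b := π) fun θ => G (cos θ)
    simp only [cos_neg, neg_zero] at this
    exact this.symm
  have h4 := intervalIntegral.integral_add_adjacent_intervals (hi (-(2 * π)) 0) (hi 0 (2 * π))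
  have h5 := intervalIntegral.integral_add_adjacent_intervals (hi (-π) 0) (hi 0 π)
  rw [show -(2 * π) + 2 * π = 0 by ring, show -π + 2 * π = π by ring] at h1
  rw [show 0 + 2 * π = 2 * π by ring, show -π + 2 * π = π by ring] at h2
  linarith

/-- A family of branches `v i` of `[-1,1]` whose derivatives are `σ i * ℓ i * ω i` with a sign
`σ i`, a length `ℓ i` and a normalised density `ω i` that is uniformly regular and bounded
below. -/
structure UniformBranches {ι : Type} (r : ℕ) (δ : ℝ) (ℓ σ : ι → ℝ) (ω v : ι → ℝ → ℝ) : Prop where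
  pos_lower : 0 < δ
  pos_length : ∀ i, 0 < ℓ i
  length_le : ∀ i, ℓ i ≤ 2
  sign : ∀ i, σ i = 1 ∨ σ i = -1
  regular : UniformlyCk (Icc (-1) 1) r ω
  lower : ∀ i, ∀ x ∈ Icc (-1 : ℝ) 1, δ ≤ ω i x
  hasDeriv : ∀ i, ∀ x ∈ Icc (-1 : ℝ) 1,
    HasDerivWithinAt (v i) (σ i * ℓ i * ω i x) (Icc (-1) 1) x
  mem_Icc : ∀ i, ∀ x ∈ Icc (-1 : ℝ) 1, v i x ∈ Icc (-1 : ℝ) 1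

namespace UniformBranches

variable {ι κ : Type} {r : ℕ} {δ c μ : ℝ} {ℓ σ : ι → ℝ} {ω v : ι → ℝ → ℝ}

theorem comp_index (h : UniformBranches r δ ℓ σ ω v) (f : κ → ι) :
    UniformBranches r δ (fun k => ℓ (f k)) (fun k => σ (f k)) (fun k => ω (f k))
      (fun k => v (f k)) where
  pos_lower := h.pos_lower
  pos_length _ := h.pos_length _
  length_le _ := h.length_le _
  sign _ := h.sign _
  regular := h.regular.comp_index f
  lower _ := h.lower _
  hasDeriv _ := h.hasDeriv _
  mem_Icc _ := h.mem_Icc _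

theorem abs_sign (h : UniformBranches r δ ℓ σ ω v) (i : ι) : |σ i| = 1 := by
  rcases h.sign i with h | h <;> simp [h]

theorem hasDerivAt_comp_cos (h : UniformBranches r δ ℓ σ ω v) (i : ι) (θ : ℝ) :
    HasDerivAt (fun θ => v i (Real.cos θ))
      (σ i * ℓ i * ω i (Real.cos θ) * -Real.sin θ) θ := by
  have := (h.hasDeriv i _ (Real.cos_mem_Icc θ)).comp θ
    ((Real.hasDerivAt_cos θ).hasDerivWithinAt (s := univ)) fun t _ => Real.cos_mem_Icc t
  exact hasDerivWithinAt_univ.1 this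

theorem uniformlyCk (h : UniformBranches r δ ℓ σ ω v) : UniformlyCk (Icc (-1) 1) r v := by
  refine UniformlyCk.of_succ ⟨⟨1, fun i x hx => abs_le.2 (h.mem_Icc i x hx)⟩, _, h.hasDeriv,
    UniformlyCk.const_mul (c := fun i => σ i * ℓ i) (K := 2) (fun i => ?_) h.regular⟩
  rw [abs_mul, h.abs_sign, one_mul, abs_of_pos (h.pos_length i)]
  exact h.length_le i

open Real in
/-- A smooth angular lift of branches whose images stay away from both endpoints. -/
theorem exists_lift_of_away (h : UniformBranches r δ ℓ σ ω v) (hc : 0 < c)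
    (hpos : ∀ i, ∀ x ∈ Icc (-1 : ℝ) 1, c * ℓ i ≤ 1 + v i x)
    (hneg : ∀ i, ∀ x ∈ Icc (-1 : ℝ) 1, c * ℓ i ≤ 1 - v i x) :
    ∃ g γ : ι → ℝ → ℝ, UniformlyCk univ r γ ∧ (∀ i θ, HasDerivAt (g i) (γ i θ) θ) ∧
      (∀ i θ, cos (g i θ) = v i (cos θ)) ∧ ∀ i, Function.Periodic (g i) (4 * π) := by
  have hℓ := h.pos_length
  let D : ι → ℝ → ℝ := fun i x => (1 - v i x ^ 2) / ℓ i
  have hD : ∀ i, ∀ x ∈ Icc (-1 : ℝ) 1, c ≤ D i x := fun i x hx => by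
    have h1 := hpos i x hx
    have h2 := hneg i x hx
    have h3 := mul_pos hc (hℓ i)
    simp only [D]
    rw [le_div_iff₀ (hℓ i)]
    rcases le_total 0 (v i x) with h0 | h0 <;> nlinarith
  have hDd : ∀ i, ∀ x ∈ Icc (-1 : ℝ) 1,
      HasDerivWithinAt (D i) ((-2 * σ i) * (v i x * ω i x)) (Icc (-1) 1) x := fun i x hx => by
    refine ((((h.hasDeriv i x hx).pow 2).const_sub 1).div_const (ℓ i)).congr_deriv ?_
    have := (hℓ i).ne'
    field_simp
    simp only [Nat.cast_ofNat, Nat.add_one_sub_one, pow_one]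
    ring
  have hDr : UniformlyCk (Icc (-1) 1) r fun i x => (√(D i x))⁻¹ :=
    (UniformlyCk.inv_sqrt_of_deriv hc hD hDd (UniformlyCk.const_mul (c := fun i => -2 * σ i)
      (K := 2) (fun i => by simp [abs_mul, h.abs_sign]) (h.uniformlyCk.mul h.regular))).of_succ
  refine ⟨fun i θ => arccos (v i (cos θ)),
    fun i θ => (σ i * √(ℓ i)) * (sin θ * (ω i (cos θ) * (√(D i (cos θ)))⁻¹)),
    UniformlyCk.const_mul (K := √2) (fun i => ?_) (UniformlyCk.mul ?_
      (h.regular.mul hDr).comp_cos), fun i θ => ?_, fun i θ => ?_, fun i θ => ?_⟩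
  · rw [abs_mul, h.abs_sign, one_mul, abs_of_nonneg (sqrt_nonneg _)]
    exact sqrt_le_sqrt (h.length_le i)
  · simpa using UniformlyCk.sin_affine (ι := ι) (S := univ) (n := r) 1 fun _ => 0
  · have hx := cos_mem_Icc θ
    have h1 := hpos i _ hx
    have h2 := hneg i _ hx
    have h3 := mul_pos hc (hℓ i)
    refine ((hasDerivAt_arccos (by linarith) (by linarith)).comp θ
      (h.hasDerivAt_comp_cos i θ)).congr_deriv ?_
    have e : √(1 - v i (cos θ) ^ 2) = √(ℓ i) * √(D i (cos θ)) := by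
      rw [← sqrt_mul (hℓ i).le]
      congr 1
      simp only [D]
      field_simp [(hℓ i).ne']
    have hs := sqrt_pos.2 (hℓ i)
    have hs' := sqrt_pos.2 (hc.trans_le (hD i _ hx))
    have hss := sq_sqrt (hℓ i).le
    rw [e]
    field_simp
    rw [hss]
    ring
  · exact cos_arccos (h.mem_Icc i _ (cos_mem_Icc θ)).1 (h.mem_Icc i _ (cos_mem_Icc θ)).2
  · have : cos (θ + 4 * π) = cos θ := by
      rw [show θ + 4 * π = θ + 2 * π + 2 * π by ring, cos_add_two_pi, cos_add_two_pi]
    simp only [this]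

open Real in
/-- An angular lift of expanding branches contracts uniformly. -/
theorem abs_deriv_lift_le (h : UniformBranches r δ ℓ σ ω v)
    (hCE : ∀ i, ∀ x ∈ Ioo (-1 : ℝ) 1,
      √(1 - x ^ 2) * |σ i * ℓ i * ω i x| ≤ μ * √(1 - v i x ^ 2))
    {g γ : ι → ℝ → ℝ} (hγ : ∀ i, Continuous (γ i)) (hg : ∀ i θ, HasDerivAt (g i) (γ i θ) θ)
    (hcos : ∀ i θ, cos (g i θ) = v i (cos θ)) (i : ι) (θ : ℝ) : |γ i θ| ≤ μ := by
  have hdense : Dense {θ : ℝ | sin θ ≠ 0} := by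
    have hcount : {θ : ℝ | sin θ = 0}.Countable :=
      (countable_range fun n : ℤ => (n : ℝ) * π).mono fun θ hθ => sin_eq_zero_iff.1 hθ
    exact hcount.dense_compl ℝ
  have hclosed : IsClosed {θ : ℝ | |γ i θ| ≤ μ} :=
    isClosed_le (hγ i).abs continuous_const
  refine hclosed.closure_subset_iff.2 (fun t ht => ?_) (hdense θ)
  have hsin : 0 < |sin t| := abs_pos.2 ht
  have hsq := sin_sq_add_cos_sq t
  have hs2 : 0 < sin t ^ 2 := by rw [← sq_abs]; positivity
  have hx : cos t ∈ Ioo (-1 : ℝ) 1 := by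
    constructor <;> nlinarith
  have hCEx := hCE i _ hx
  have e1 : √(1 - cos t ^ 2) = |sin t| := by rw [← sin_sq, sqrt_sq_eq_abs]
  have e2 : √(1 - v i (cos t) ^ 2) = |sin (g i t)| := by
    rw [← hcos i t, ← sin_sq, sqrt_sq_eq_abs]
  have e3 : |σ i * ℓ i * ω i (cos t)| * |sin t| = |sin (g i t)| * |γ i t| := by
    have h1 := (hg i t).cos
    simp only [hcos i] at h1
    have := h1.unique (h.hasDerivAt_comp_cos i t)
    rw [← abs_mul, ← abs_mul, ← abs_neg, ← abs_neg (sin (g i t) * γ i t)]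
    congr 1
    linarith
  rw [e1, e2] at hCEx
  have hv : 0 < |σ i * ℓ i * ω i (cos t)| := by
    have := h.pos_lower.trans_le (h.lower i _ (Ioo_subset_Icc_self hx))
    rw [abs_mul, abs_mul, h.abs_sign, one_mul]
    exact mul_pos (abs_pos.2 (h.pos_length i).ne') (abs_pos.2 this.ne')
  have hsg : 0 < |sin (g i t)| := by
    refine lt_of_le_of_ne (abs_nonneg _) fun h0 => ?_
    rw [← h0, mul_zero] at hCEx
    exact absurd (mul_pos hsin hv) hCEx.not_gt
  rw [mul_comm, e3, mul_comm] at hCEx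
  exact le_of_mul_le_mul_right hCEx hsg

theorem sub_eq_mul_average (h : UniformBranches r δ ℓ σ ω v) (i : ι) {e x : ℝ}
    (he : e ∈ Icc (-1 : ℝ) 1) (hx : x ∈ Icc (-1 : ℝ) 1) :
    v i x - v i e = σ i * ℓ i * ((x - e) * ∫ t in (0 : ℝ)..1, ω i (e + t * (x - e))) := by
  have hm : MapsTo (fun t => e + t * (x - e)) (Icc 0 1) (Icc (-1) 1) :=
    fun t ht => segment_mem_Icc he hx ht
  have hd : ∀ t ∈ Icc (0 : ℝ) 1, HasDerivWithinAt (fun t => v i (e + t * (x - e)))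
      (σ i * ℓ i * ω i (e + t * (x - e)) * (1 * (x - e))) (Icc 0 1) t := fun t ht =>
    (h.hasDeriv i _ (hm ht)).comp t
      ((((hasDerivAt_id t).mul_const (x - e)).const_add e).hasDerivWithinAt) hm
  have hc : ContinuousOn (fun t => ω i (e + t * (x - e))) (Icc 0 1) :=
    (h.regular.continuousOn i).comp (by fun_prop) hm
  have := intervalIntegral.integral_eq_sub_of_hasDerivAt_of_le zero_le_one
    (fun t ht => (hd t ht).continuousWithinAt)
    (fun t ht => (hd t (Ioo_subset_Icc_self ht)).hasDerivAt (Icc_mem_nhds ht.1 ht.2))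
    (ContinuousOn.intervalIntegrable (by
      rw [uIcc_of_le zero_le_one]
      exact (continuousOn_const.mul hc).mul continuousOn_const))
  rw [intervalIntegral.integral_mul_const, intervalIntegral.integral_const_mul] at this
  simp only [one_mul, add_sub_cancel, zero_mul, add_zero] at this
  rw [← this]
  ring

theorem lower_average (h : UniformBranches r δ ℓ σ ω v) (i : ι) {e x : ℝ}
    (he : e ∈ Icc (-1 : ℝ) 1) (hx : x ∈ Icc (-1 : ℝ) 1) :
    δ ≤ ∫ t in (0 : ℝ)..1, ω i (e + t * (x - e)) := by
  have hm : MapsTo (fun t => e + t * (x - e)) (Icc 0 1) (Icc (-1) 1) :=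
    fun t ht => segment_mem_Icc he hx ht
  have hc : ContinuousOn (fun t => ω i (e + t * (x - e))) (Icc 0 1) :=
    (h.regular.continuousOn i).comp (by fun_prop) hm
  have := intervalIntegral.integral_mono_on (μ := volume) (f := fun _ => δ)
    (g := fun t => ω i (e + t * (x - e))) zero_le_one intervalIntegrable_const
    (ContinuousOn.intervalIntegrable (by rwa [uIcc_of_le zero_le_one]))
    fun t ht => h.lower i _ (hm ht)
  simpa using this

open Real in
/-- A smooth angular lift of branches that map the endpoint `cos (β i)` to the endpoint `τ i` and
whose images stay away from the endpoint `-τ i`. -/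
theorem exists_lift_of_touching (h : UniformBranches (r + 1) δ ℓ σ ω v) (hc : 0 < c)
    {β τ : ι → ℝ} (hβ : ∀ i, β i = 0 ∨ β i = π) (hτ : ∀ i, τ i = 1 ∨ τ i = -1)
    (hv : ∀ i, v i (cos (β i)) = τ i)
    (haway : ∀ i, ∀ x ∈ Icc (-1 : ℝ) 1, c * ℓ i ≤ 1 + τ i * v i x) :
    ∃ g γ : ι → ℝ → ℝ, UniformlyCk univ (r + 1) γ ∧ (∀ i θ, HasDerivAt (g i) (γ i θ) θ) ∧
      (∀ i θ, cos (g i θ) = v i (cos θ)) ∧ ∀ i, Function.Periodic (g i) (4 * π) := by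
  have hℓ := h.pos_length
  set e : ι → ℝ := fun i => cos (β i) with he_def
  have hsinβ : ∀ i, sin (β i) = 0 := fun i => by rcases hβ i with h | h <;> simp [h]
  have he1 : ∀ i, e i = 1 ∨ e i = -1 := fun i => by rcases hβ i with h | h <;> simp [he_def, h]
  have hesq : ∀ i, e i * e i = 1 := fun i => by rcases he1 i with h | h <;> simp [h]
  have hτsq : ∀ i, τ i * τ i = 1 := fun i => by rcases hτ i with h | h <;> simp [h]
  have heI : ∀ i, e i ∈ Icc (-1 : ℝ) 1 := fun i => cos_mem_Icc _
  let η : ι → ℝ → ℝ := fun i x => ∫ t in (0 : ℝ)..1, ω i (e i + t * (x - e i))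
  have hη : UniformlyCk (Icc (-1) 1) (r + 1) η := by
    simpa [η] using h.regular.average heI 0
  have hηδ : ∀ i, ∀ x ∈ Icc (-1 : ℝ) 1, δ ≤ η i x := fun i x hx => h.lower_average i (heI i) hx
  obtain ⟨η', hη'⟩ : ∃ η' : ι → ℝ → ℝ, ∀ i, ∀ x ∈ Icc (-1 : ℝ) 1,
      HasDerivWithinAt (η i) (η' i x) (Icc (-1) 1) x := by
    obtain ⟨-, η', h1, -⟩ := hη
    exact ⟨η', h1⟩
  have hsub : ∀ i, ∀ x ∈ Icc (-1 : ℝ) 1, v i x - τ i = σ i * ℓ i * ((x - e i) * η i x) :=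
    fun i x hx => by rw [← hv i]; exact h.sub_eq_mul_average i (heI i) hx
  have hode : ∀ i, ∀ x ∈ Icc (-1 : ℝ) 1, η i x + (x - e i) * η' i x = ω i x := fun i x hx => by
    have h1 : HasDerivWithinAt (fun x => v i x - τ i)
        (σ i * ℓ i * (1 * η i x + (x - e i) * η' i x)) (Icc (-1) 1) x :=
      (((((hasDerivAt_id x).sub_const (e i)).hasDerivWithinAt).mul (hη' i x hx)).const_mul
        (σ i * ℓ i)).congr (hsub i) (hsub i x hx)
    have h2 := UniqueDiffWithinAt.eq_deriv _ (uniqueDiffOn_Icc (by norm_num) x hx) h1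
      ((h.hasDeriv i x hx).sub_const _)
    have h3 : σ i * ℓ i ≠ 0 := mul_ne_zero (by rcases h.sign i with h | h <;> simp [h]) (hℓ i).ne'
    rw [one_mul] at h2
    exact mul_left_cancel₀ h3 h2
  have hsign : ∀ i, τ i * σ i = e i := fun i => by
    have hx : -e i ∈ Icc (-1 : ℝ) 1 := ⟨by linarith [(heI i).2], by linarith [(heI i).1]⟩
    have h1 := hsub i _ hx
    have h2 := mul_pos (hℓ i) (h.pos_lower.trans_le (hηδ i _ hx))
    have h3 := h.mem_Icc i _ hx
    rcases h.sign i with hs | hs <;> rcases hτ i with ht | ht <;> rcases he1 i with h' | h' <;>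
      simp only [hs, ht, h'] at h1 h2 h3 ⊢ <;> norm_num at h1 h2 h3 ⊢ <;>
      linarith [h3.1, h3.2]
  have hgap : ∀ i, ∀ x ∈ Icc (-1 : ℝ) 1, 1 - τ i * v i x = (1 - e i * x) * (ℓ i * η i x) :=
    fun i x hx => by
      linear_combination (-τ i) * hsub i x hx - hτsq i - (x - e i) * ℓ i * η i x * hsign i +
        ℓ i * η i x * hesq i
  let s : ι → ℝ → ℝ := fun i θ => sin (1 / 2 * θ + β i / 2)
  let k : ι → ℝ → ℝ := fun i θ => sin (1 / 2 * θ + (β i / 2 + π / 2))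
  have hk : ∀ i θ, k i θ = cos (1 / 2 * θ + β i / 2) := fun i θ => by
    simp only [k, ← add_assoc, sin_add_pi_div_two]
  have hsd : ∀ i θ, HasDerivAt (s i) (1 / 2 * k i θ) θ := fun i θ => by
    refine ((((hasDerivAt_id θ).const_mul (1 / 2)).add_const (β i / 2)).sin).congr_deriv ?_
    rw [hk, mul_comm]
    simp
  have hs2 : ∀ i θ, 2 * s i θ ^ 2 = 1 - e i * cos θ := fun i θ => by
    have h1 : cos (2 * (1 / 2 * θ + β i / 2)) = e i * cos θ := by
      rw [show 2 * (1 / 2 * θ + β i / 2) = θ + β i by ring, cos_add, hsinβ]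
      simp only [he_def]
      ring
    rw [← h1, cos_two_mul, cos_sq']
    simp only [s]
    ring
  have hsk : ∀ i θ, sin θ = 2 * e i * s i θ * k i θ := fun i θ => by
    have h1 : sin (2 * (1 / 2 * θ + β i / 2)) = e i * sin θ := by
      rw [show 2 * (1 / 2 * θ + β i / 2) = θ + β i by ring, sin_add, hsinβ]
      simp only [he_def]
      ring
    rw [sin_two_mul, ← hk] at h1
    simp only [s] at h1 ⊢
    linear_combination (-sin θ) * hesq i - e i * h1
  let D : ι → ℝ → ℝ := fun i x => (1 + τ i * v i x) / (2 * ℓ i)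
  have hc2 : 0 < c / 2 := by positivity
  have hD : ∀ i, ∀ x ∈ Icc (-1 : ℝ) 1, c / 2 ≤ D i x := fun i x hx => by
    simp only [D]
    rw [div_le_div_iff₀ two_pos (by linarith [hℓ i])]
    linarith [haway i x hx]
  have hDd : ∀ i, ∀ x ∈ Icc (-1 : ℝ) 1,
      HasDerivWithinAt (D i) ((τ i * σ i / 2) * ω i x) (Icc (-1) 1) x := fun i x hx => by
    refine ((((h.hasDeriv i x hx).const_mul (τ i)).const_add 1).div_const
      (2 * ℓ i)).congr_deriv ?_
    have := (hℓ i).ne'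
    field_simp
  have hDr : UniformlyCk (Icc (-1) 1) (r + 1) fun i x => (√(D i x))⁻¹ :=
    (UniformlyCk.inv_sqrt_of_deriv hc2 hD hDd (UniformlyCk.const_mul
      (c := fun i => τ i * σ i / 2) (K := 1) (fun i => by
        rw [hsign]; rcases he1 i with h | h <;> rw [h] <;> norm_num [abs_le]) h.regular)).of_succ
  let S : ι → ℝ → ℝ := fun i θ => s i θ * √(ℓ i * η i (cos θ))
  have hηpos : ∀ i θ, 0 < η i (cos θ) := fun i θ =>
    h.pos_lower.trans_le (hηδ i _ (cos_mem_Icc θ))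
  have hDpos : ∀ i θ, 0 < D i (cos θ) := fun i θ => hc2.trans_le (hD i _ (cos_mem_Icc θ))
  have hS2 : ∀ i θ, 2 * S i θ ^ 2 = 1 - τ i * v i (cos θ) := fun i θ => by
    rw [hgap i _ (cos_mem_Icc θ), ← hs2]
    simp only [S]
    rw [mul_pow, sq_sqrt (mul_pos (hℓ i) (hηpos i θ)).le]
    ring
  have hS1 : ∀ i θ, 1 - S i θ ^ 2 = ℓ i * D i (cos θ) := fun i θ => by
    have := (hℓ i).ne'
    simp only [D]
    field_simp
    linarith [hS2 i θ]
  have hSlt : ∀ i θ, S i θ ^ 2 < 1 := fun i θ => by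
    have := mul_pos (hℓ i) (hDpos i θ)
    linarith [hS1 i θ]
  have hSd : ∀ i θ, HasDerivAt (S i)
      (k i θ * ℓ i * ω i (cos θ) / (2 * √(ℓ i * η i (cos θ)))) θ := fun i θ => by
    have h1 : HasDerivAt (fun θ => η i (cos θ)) (η' i (cos θ) * -sin θ) θ :=
      hasDerivWithinAt_univ.1 ((hη' i _ (cos_mem_Icc θ)).comp θ
        ((hasDerivAt_cos θ).hasDerivWithinAt (s := univ)) fun t _ => cos_mem_Icc t)
    have hP := mul_pos (hℓ i) (hηpos i θ)
    refine ((hsd i θ).mul ((h1.const_mul (ℓ i)).sqrt hP.ne')).congr_deriv ?_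
    have h2 := sqrt_pos.2 hP
    have h3 := sq_sqrt hP.le
    have h4 := hode i _ (cos_mem_Icc θ)
    have h5 := hs2 i θ
    have h6 := hsk i θ
    field_simp
    rw [h3, h6]
    linear_combination (k i θ * ℓ i) * h4 - (k i θ * ℓ i * e i * η' i (cos θ)) * h5 +
      k i θ * ℓ i * cos θ * η' i (cos θ) * hesq i
  refine ⟨fun i θ => (1 - τ i) / 2 * π + 2 * arcsin (S i θ),
    fun i θ => k i θ * (ω i (cos θ) * ((√(η i (cos θ)))⁻¹ * (√(D i (cos θ)))⁻¹)),
    (UniformlyCk.sin_affine _ _).mul (h.regular.mul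
      ((UniformlyCk.inv_sqrt h.pos_lower hηδ hη).mul hDr)).comp_cos,
    fun i θ => ?_, fun i θ => ?_, fun i θ => ?_⟩
  · have hlt := abs_lt.1 ((sq_lt_one_iff_abs_lt_one _).1 (hSlt i θ))
    refine ((((hasDerivAt_arcsin hlt.1.ne' hlt.2.ne).comp θ (hSd i θ)).const_mul 2).const_add
      _).congr_deriv ?_
    rw [hS1, sqrt_mul (hℓ i).le, sqrt_mul (hℓ i).le]
    have h1 := sqrt_pos.2 (hℓ i)
    have h2 := sqrt_pos.2 (hηpos i θ)
    have h3 := sqrt_pos.2 (hDpos i θ)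
    have h4 := sq_sqrt (hℓ i).le
    field_simp
    rw [h4]
    ring
  · have hlt := abs_lt.1 ((sq_lt_one_iff_abs_lt_one _).1 (hSlt i θ))
    have h1 : cos (2 * arcsin (S i θ)) = τ i * v i (cos θ) := by
      rw [cos_two_mul, cos_sq', sin_arcsin hlt.1.le hlt.2.le]
      linarith [hS2 i θ]
    show cos ((1 - τ i) / 2 * π + 2 * arcsin (S i θ)) = v i (cos θ)
    rcases hτ i with ht | ht
    · rw [ht] at h1 ⊢
      simpa using h1
    · rw [ht] at h1 ⊢
      rw [show (1 - (-1 : ℝ)) / 2 * π + 2 * arcsin (S i θ) = 2 * arcsin (S i θ) + π by ring,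
        cos_add_pi, h1]
      ring
  · have h1 : cos (θ + 4 * π) = cos θ := by
      rw [show θ + 4 * π = θ + 2 * π + 2 * π by ring, cos_add_two_pi, cos_add_two_pi]
    have h2 : s i (θ + 4 * π) = s i θ := by
      simp only [s]
      rw [show 1 / 2 * (θ + 4 * π) + β i / 2 = 1 / 2 * θ + β i / 2 + 2 * π by ring, sin_add_two_pi]
    simp only [S, h1, h2]

end UniformBranches

theorem abs_le_exp_mul_of_abs_deriv_le {f f' : ℝ → ℝ} {K : ℝ} (hK : 0 ≤ K)
    (hf : ∀ x ∈ Icc (-1 : ℝ) 1, HasDerivWithinAt f (f' x) (Icc (-1) 1) x)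
    (hf' : ∀ x ∈ Icc (-1 : ℝ) 1, |f' x| ≤ K * |f x|) {x y : ℝ}
    (hx : x ∈ Icc (-1 : ℝ) 1) (hy : y ∈ Icc (-1 : ℝ) 1) :
    |f x| ≤ Real.exp (2 * K) * |f y| := by
  have key : ∀ g g' : ℝ → ℝ,
      (∀ x ∈ Icc (-1 : ℝ) 1, HasDerivWithinAt g (g' x) (Icc (-1) 1) x) →
      (∀ x ∈ Icc (-1 : ℝ) 1, |g' x| ≤ K * |g x|) → ∀ x ∈ Icc (-1 : ℝ) 1,
      ∀ y ∈ Icc (-1 : ℝ) 1, y ≤ x → |g x| ≤ Real.exp (2 * K) * |g y| := by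
    intro g g' hg hg' x hx y hy hyx
    have hsub : Icc y x ⊆ Icc (-1 : ℝ) 1 := Icc_subset_Icc hy.1 hx.2
    have h := norm_le_gronwallBound_of_norm_deriv_right_le (f := g) (f' := g') (δ := |g y|)
      (K := K) (ε := 0) (a := y) (b := x)
      (fun t ht => (hg t (hsub ht)).continuousWithinAt.mono hsub)
      (fun t ht => by
        refine (hg t (hsub (Ico_subset_Icc_self ht))).mono_of_mem_nhdsWithin ?_
        exact mem_nhdsGE_iff_exists_Icc_subset.2
          ⟨1, ht.2.trans_le hx.2, Icc_subset_Icc_left (hy.1.trans ht.1)⟩)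
      le_rfl (fun t ht => by simpa using hg' t (hsub (Ico_subset_Icc_self ht)))
      x (right_mem_Icc.2 hyx)
    rw [gronwallBound_ε0, Real.norm_eq_abs, mul_comm] at h
    refine h.trans (mul_le_mul_of_nonneg_right (Real.exp_le_exp.2 ?_) (abs_nonneg _))
    nlinarith [hx.2, hy.1]
  rcases le_total y x with hyx | hyx
  · exact key f f' hf hf' x hx y hy hyx
  · have hneg : ∀ t ∈ Icc (-1 : ℝ) 1, -t ∈ Icc (-1 : ℝ) 1 := fun t ht =>
      ⟨by linarith [ht.2], by linarith [ht.1]⟩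
    have h := key (fun t => f (-t)) (fun t => f' (-t) * -1)
      (fun t ht => (hf _ (hneg t ht)).comp t ((hasDerivAt_id t).neg.hasDerivWithinAt) hneg)
      (fun t ht => by simpa using hf' _ (hneg t ht)) (-x) (hneg x hx) (-y) (hneg y hy)
      (neg_le_neg hyx)
    simpa using h

theorem UniformlyCk.of_iteratedDerivWithin {ι : Type} {r : ℕ} {v : ι → ℝ → ℝ}
    (hreg : ∀ i, ContDiffOn ℝ (r + 1 : ℕ) (v i) (Icc (-1) 1)) {c : ι → ℝ} {K : ℕ → ℝ}
    (hK : ∀ n ≤ r, ∀ i, ∀ x ∈ Icc (-1 : ℝ) 1,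
      |c i * iteratedDerivWithin (n + 1) (v i) (Icc (-1) 1) x| ≤ K n) :
    UniformlyCk (Icc (-1) 1) r fun i x => c i * derivWithin (v i) (Icc (-1) 1) x := by
  have hU : UniqueDiffOn ℝ (Icc (-1 : ℝ) 1) := uniqueDiffOn_Icc (by norm_num)
  have key : ∀ m n, m + n = r → UniformlyCk (Icc (-1) 1) m
      fun i x => c i * iteratedDerivWithin (n + 1) (v i) (Icc (-1) 1) x := by
    intro m
    induction m with
    | zero =>
      intro n hn
      refine ⟨⟨K n, hK n (by omega)⟩, fun i => continuousOn_const.mul ?_⟩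
      exact (hreg i).continuousOn_iteratedDerivWithin (by exact_mod_cast (by omega)) hU
    | succ m ih =>
      intro n hn
      refine ⟨⟨K n, hK n (by omega)⟩, _, fun i x hx => ?_, ih (n + 1) (by omega)⟩
      have hd := (hreg i).differentiableOn_iteratedDerivWithin (m := n + 1)
        (by exact_mod_cast (by omega)) hU x hx
      have := hd.hasDerivWithinAt.const_mul (c i)
      rwa [← iteratedDerivWithin_succ] at this
  simpa [iteratedDerivWithin_one] using key r 0 rfl

theorem StrictMonoOn.endpoints_of_image {f : ℝ → ℝ} {a b : ℝ} (hf : StrictMonoOn f (Icc (-1) 1))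
    (him : f '' Icc (-1) 1 = Icc a b) (hab : a ≤ b) : f (-1) = a ∧ f 1 = b := by
  have hl : (-1 : ℝ) ∈ Icc (-1 : ℝ) 1 := by simp
  have hr : (1 : ℝ) ∈ Icc (-1 : ℝ) 1 := by simp
  obtain ⟨x, hx, hxa⟩ : a ∈ f '' Icc (-1) 1 := him ▸ left_mem_Icc.2 hab
  obtain ⟨y, hy, hyb⟩ : b ∈ f '' Icc (-1) 1 := him ▸ right_mem_Icc.2 hab
  have h1 : f (-1) ∈ Icc a b := him ▸ mem_image_of_mem f hl
  have h2 : f 1 ∈ Icc a b := him ▸ mem_image_of_mem f hr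
  exact ⟨le_antisymm (hxa ▸ hf.monotoneOn hl hx hx.1) h1.1,
    le_antisymm h2.2 (hyb ▸ hf.monotoneOn hy hr hy.2)⟩

theorem StrictAntiOn.endpoints_of_image {f : ℝ → ℝ} {a b : ℝ} (hf : StrictAntiOn f (Icc (-1) 1))
    (him : f '' Icc (-1) 1 = Icc a b) (hab : a ≤ b) : f (-1) = b ∧ f 1 = a := by
  have hl : (-1 : ℝ) ∈ Icc (-1 : ℝ) 1 := by simp
  have hr : (1 : ℝ) ∈ Icc (-1 : ℝ) 1 := by simp
  obtain ⟨x, hx, hxa⟩ : a ∈ f '' Icc (-1) 1 := him ▸ left_mem_Icc.2 hab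
  obtain ⟨y, hy, hyb⟩ : b ∈ f '' Icc (-1) 1 := him ▸ right_mem_Icc.2 hab
  have h1 : f (-1) ∈ Icc a b := him ▸ mem_image_of_mem f hl
  have h2 : f 1 ∈ Icc a b := him ▸ mem_image_of_mem f hr
  exact ⟨le_antisymm h1.2 (hyb ▸ hf.antitoneOn hl hy hy.1),
    le_antisymm (hxa ▸ hf.antitoneOn hx hr hx.2) h2.1⟩

/-- Branches satisfying the distortion condition have uniformly regular normalised densities. -/
theorem exists_uniformBranches {ι : Type} {r : ℕ} (hr : 1 ≤ r) {a b : ι → ℝ}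
    (hab : ∀ i, a i < b i) (ha : ∀ i, -1 ≤ a i) (hb : ∀ i, b i ≤ 1) {v : ι → ℝ → ℝ}
    (hreg : ∀ i, ContDiffOn ℝ (r + 1 : ℕ) (v i) (Icc (-1) 1))
    (hmono : ∀ i, StrictMonoOn (v i) (Icc (-1) 1) ∨ StrictAntiOn (v i) (Icc (-1) 1))
    (himage : ∀ i, v i '' Icc (-1) 1 = Icc (a i) (b i)) {C : ℕ → ℝ}
    (hC : ∀ n, 1 ≤ n → n ≤ r → ∀ i, ∀ x ∈ Icc (-1 : ℝ) 1,
      |iteratedDerivWithin (n + 1) (v i) (Icc (-1) 1) x| ≤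
        C n * |derivWithin (v i) (Icc (-1) 1) x|) :
    ∃ (δ : ℝ) (σ : ι → ℝ) (ω : ι → ℝ → ℝ), UniformBranches r δ (fun i => b i - a i) σ ω v ∧
      ∀ i x, derivWithin (v i) (Icc (-1) 1) x = σ i * (b i - a i) * ω i x := by
  have hU : UniqueDiffOn ℝ (Icc (-1 : ℝ) 1) := uniqueDiffOn_Icc (by norm_num)
  have hℓ : ∀ i, 0 < b i - a i := fun i => sub_pos.2 (hab i)
  have hd : ∀ i, ∀ x ∈ Icc (-1 : ℝ) 1,
      HasDerivWithinAt (v i) (derivWithin (v i) (Icc (-1) 1) x) (Icc (-1) 1) x := fun i x hx =>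
    ((hreg i).differentiableOn (by exact_mod_cast r.succ_ne_zero) x hx).hasDerivWithinAt
  have hdist : ∀ i, ∀ x ∈ Icc (-1 : ℝ) 1, ∀ y ∈ Icc (-1 : ℝ) 1,
      |derivWithin (v i) (Icc (-1) 1) x| ≤
        Real.exp (2 * |C 1|) * |derivWithin (v i) (Icc (-1) 1) y| := fun i x hx y hy => by
    refine abs_le_exp_mul_of_abs_deriv_le (f := derivWithin (v i) (Icc (-1) 1))
      (f' := iteratedDerivWithin 2 (v i) (Icc (-1) 1)) (abs_nonneg _) (fun t ht => ?_)
      (fun t ht => (hC 1 le_rfl hr i t ht).trans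
        (mul_le_mul_of_nonneg_right (le_abs_self _) (abs_nonneg _))) hx hy
    have := (hreg i).differentiableOn_iteratedDerivWithin (m := 1)
        (by exact_mod_cast (by omega)) hU t ht
    have := this.hasDerivWithinAt
    rw [← iteratedDerivWithin_succ, iteratedDerivWithin_one] at this
    exact this
  have hmean : ∀ i, ∃ y ∈ Icc (-1 : ℝ) 1,
      |derivWithin (v i) (Icc (-1) 1) y| = (b i - a i) / 2 := fun i => by
    obtain ⟨y, hy, h⟩ := exists_hasDerivAt_eq_slope (v i) (derivWithin (v i) (Icc (-1) 1))
      (by norm_num : (-1 : ℝ) < 1) (hreg i).continuousOn fun x hx =>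
        (hd i x (Ioo_subset_Icc_self hx)).hasDerivAt (Icc_mem_nhds hx.1 hx.2)
    refine ⟨y, Ioo_subset_Icc_self hy, ?_⟩
    rw [h]
    rcases hmono i with hm | hm
    · obtain ⟨h1, h2⟩ := hm.endpoints_of_image (himage i) (hab i).le
      rw [h1, h2, abs_of_pos (div_pos (hℓ i) (by norm_num))]
      norm_num
    · obtain ⟨h1, h2⟩ := hm.endpoints_of_image (himage i) (hab i).le
      rw [h1, h2, abs_of_neg (div_neg_of_neg_of_pos (by linarith [hℓ i]) (by norm_num))]
      ring
  have hupper : ∀ i, ∀ x ∈ Icc (-1 : ℝ) 1, |derivWithin (v i) (Icc (-1) 1) x| ≤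
      Real.exp (2 * |C 1|) / 2 * (b i - a i) := fun i x hx => by
    obtain ⟨y, hy, h⟩ := hmean i
    have := hdist i x hx y hy
    rw [h] at this
    linarith
  have hlower : ∀ i, ∀ x ∈ Icc (-1 : ℝ) 1, (b i - a i) / (2 * Real.exp (2 * |C 1|)) ≤
      |derivWithin (v i) (Icc (-1) 1) x| := fun i x hx => by
    obtain ⟨y, hy, h⟩ := hmean i
    have := hdist i y hy x hx
    rw [h] at this
    rw [div_le_iff₀ (by positivity)]
    linarith
  obtain ⟨σ, hσ⟩ : ∃ σ : ι → ℝ, ∀ i, (σ i = 1 ∨ σ i = -1) ∧ ∀ x,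
      σ i * derivWithin (v i) (Icc (-1) 1) x = |derivWithin (v i) (Icc (-1) 1) x| := by
    have : ∀ i, ∃ s : ℝ, (s = 1 ∨ s = -1) ∧ ∀ x,
        s * derivWithin (v i) (Icc (-1) 1) x = |derivWithin (v i) (Icc (-1) 1) x| := fun i => by
      rcases hmono i with hm | hm
      · exact ⟨1, Or.inl rfl, fun x => by
          rw [abs_of_nonneg hm.monotoneOn.derivWithin_nonneg, one_mul]⟩
      · exact ⟨-1, Or.inr rfl, fun x => by
          rw [abs_of_nonpos hm.antitoneOn.derivWithin_nonpos, neg_one_mul]⟩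
    choose σ hσ using this
    exact ⟨σ, hσ⟩
  have hσσ : ∀ i, σ i * σ i = 1 := fun i => by rcases (hσ i).1 with h | h <;> simp [h]
  have habsσ : ∀ i, |σ i| = 1 := fun i => by rcases (hσ i).1 with h | h <;> simp [h]
  have hω : ∀ i x, derivWithin (v i) (Icc (-1) 1) x =
      σ i * (b i - a i) * (σ i / (b i - a i) * derivWithin (v i) (Icc (-1) 1) x) := fun i x => by
    have h1 := (hℓ i).ne'
    have h2 := hσσ i
    field_simp
    linear_combination (-derivWithin (v i) (Icc (-1) 1) x) * h2
  refine ⟨1 / (2 * Real.exp (2 * |C 1|)), σ,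
    fun i x => σ i / (b i - a i) * derivWithin (v i) (Icc (-1) 1) x,
    ⟨by positivity, hℓ, fun i => by linarith [ha i, hb i], fun i => (hσ i).1, ?_, ?_, ?_, ?_⟩, hω⟩
  · refine UniformlyCk.of_iteratedDerivWithin hreg
      (K := fun n => (1 + |C n|) * (Real.exp (2 * |C 1|) / 2)) fun n hn i x hx => ?_
    have h1 : |iteratedDerivWithin (n + 1) (v i) (Icc (-1) 1) x| ≤
        (1 + |C n|) * |derivWithin (v i) (Icc (-1) 1) x| := by
      rcases Nat.eq_zero_or_pos n with rfl | h0
      · rw [zero_add, iteratedDerivWithin_one]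
        nlinarith [mul_nonneg (abs_nonneg (C 0)) (abs_nonneg (derivWithin (v i) (Icc (-1) 1) x))]
      · refine (hC n h0 hn i x hx).trans (mul_le_mul_of_nonneg_right ?_ (abs_nonneg _))
        linarith [le_abs_self (C n)]
    rw [abs_mul, abs_div, habsσ, abs_of_pos (hℓ i), one_div_mul_eq_div, div_le_iff₀ (hℓ i),
      mul_assoc]
    exact h1.trans (mul_le_mul_of_nonneg_left (hupper i x hx) (by positivity))
  · intro i x hx
    rw [div_mul_eq_mul_div, (hσ i).2, le_div_iff₀ (hℓ i), one_div_mul_eq_div]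
    exact hlower i x hx
  · intro i x hx
    rw [← hω]
    exact hd i x hx
  · intro i x hx
    have : v i x ∈ Icc (a i) (b i) := himage i ▸ mem_image_of_mem _ hx
    exact ⟨(ha i).trans this.1, this.2.trans (hb i)⟩

theorem chebT_cos (k : ℕ) (y : ℝ) : chebT k (Real.cos y) = Real.cos (k * y) := by
  have h := Polynomial.Chebyshev.T_real_cos (Real.arccos (Real.cos y)) k
  rw [Real.cos_arccos (Real.neg_one_le_cos y) (Real.cos_le_one y),
    Polynomial.Chebyshev.T_real_cos] at h
  simpa [chebT] using h.symm

theorem continuous_chebT (k : ℕ) : Continuous (chebT k) :=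
  Real.continuous_cos.comp (continuous_const.mul Real.continuous_arccos)

theorem inv_mul_sub_le_abs_sub {a b Ξ s x : ℝ} (hab : a < b)
    (h : b - a ≤ Ξ * Metric.infDist s (Ioo a b)) (hx : x ∈ Icc a b) :
    (|Ξ| + 1)⁻¹ * (b - a) ≤ |s - x| := by
  rw [← Metric.infDist_closure, closure_Ioo hab.ne] at h
  have h1 := Metric.infDist_le_dist_of_mem (x := s) hx
  have h0 : 0 ≤ Metric.infDist s (Icc a b) := Metric.infDist_nonneg
  rw [Real.dist_eq] at h1
  rw [inv_mul_le_iff₀ (by positivity)]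
  calc b - a ≤ |Ξ| * Metric.infDist s (Icc a b) :=
        h.trans (mul_le_mul_of_nonneg_right (le_abs_self _) h0)
    _ ≤ (|Ξ| + 1) * |s - x| :=
        mul_le_mul (by linarith) h1 h0 (by positivity)

/-- A map of `[-1,1]` that contracts the arccosine metric cannot be onto. -/
theorem abs_sub_ne_two_of_contracting {f f' : ℝ → ℝ} {μ : ℝ} (hμ : μ < 1)
    (hf : ContinuousOn f (Icc (-1) 1)) (hf' : ∀ x ∈ Ioo (-1 : ℝ) 1, HasDerivAt f (f' x) x)
    (hmem : ∀ x ∈ Ioo (-1 : ℝ) 1, f x ∈ Ioo (-1 : ℝ) 1)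
    (hCE : ∀ x ∈ Ioo (-1 : ℝ) 1, √(1 - x ^ 2) * |f' x| ≤ μ * √(1 - f x ^ 2)) :
    ¬ ((f (-1) = -1 ∧ f 1 = 1) ∨ (f (-1) = 1 ∧ f 1 = -1)) := by
  intro h
  have hcos : ∀ θ ∈ Ioo 0 Real.pi, Real.cos θ ∈ Ioo (-1 : ℝ) 1 := fun θ hθ => by
    have h1 := Real.strictAntiOn_cos (left_mem_Icc.2 Real.pi_pos.le) (Ioo_subset_Icc_self hθ) hθ.1
    have h2 := Real.strictAntiOn_cos (Ioo_subset_Icc_self hθ) (right_mem_Icc.2 Real.pi_pos.le) hθ.2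
    rw [Real.cos_zero] at h1
    rw [Real.cos_pi] at h2
    exact ⟨h2, h1⟩
  obtain ⟨θ, hθ, hs⟩ := exists_hasDerivAt_eq_slope (fun θ => Real.arccos (f (Real.cos θ)))
    (fun θ => -(1 / √(1 - f (Real.cos θ) ^ 2)) * (f' (Real.cos θ) * -Real.sin θ)) Real.pi_pos
    (Real.continuous_arccos.comp_continuousOn
      (hf.comp Real.continuous_cos.continuousOn fun t _ => Real.cos_mem_Icc t))
    fun t ht => by
      have h1 := hmem _ (hcos t ht)
      exact HasDerivAt.comp (h₂ := Real.arccos) t (Real.hasDerivAt_arccos h1.1.ne' h1.2.ne)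
        ((hf' _ (hcos t ht)).comp t (Real.hasDerivAt_cos t))
  have h1 := hmem _ (hcos θ hθ)
  have h2 : 0 < √(1 - f (Real.cos θ) ^ 2) := Real.sqrt_pos.2 (by nlinarith [h1.1, h1.2])
  have h3 := hCE _ (hcos θ hθ)
  rw [← Real.sin_sq, Real.sqrt_sq (Real.sin_pos_of_mem_Ioo hθ).le] at h3
  have h4 : |-(1 / √(1 - f (Real.cos θ) ^ 2)) * (f' (Real.cos θ) * -Real.sin θ)| ≤ μ := by
    rw [neg_mul, abs_neg, abs_mul, abs_mul, abs_neg, abs_of_pos (one_div_pos.2 h2),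
      abs_of_pos (Real.sin_pos_of_mem_Ioo hθ), one_div_mul_eq_div, div_le_iff₀ h2, mul_comm |_|]
    exact h3
  rw [hs, Real.cos_pi, Real.cos_zero] at h4
  have h5 := Real.pi_pos.ne'
  rcases h with ⟨h6, h7⟩ | ⟨h6, h7⟩ <;> rw [h6, h7] at h4 <;>
    simp [h5] at h4 <;> linarith

namespace UniformBranches

variable {ι : Type} {r : ℕ} {δ c μ p : ℝ} {ℓ σ : ι → ℝ} {ω v : ι → ℝ → ℝ}

theorem exists_integral_bound_of_lift (h : UniformBranches r δ ℓ σ ω v) (hμ : 0 < μ) (hμp : μ < p)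
    (hCE : ∀ i, ∀ x ∈ Ioo (-1 : ℝ) 1,
      √(1 - x ^ 2) * |σ i * ℓ i * ω i x| ≤ μ * √(1 - v i x ^ 2))
    {g γ : ι → ℝ → ℝ} (hγ : UniformlyCk univ r γ) (hg : ∀ i θ, HasDerivAt (g i) (γ i θ) θ)
    (hcos : ∀ i θ, Real.cos (g i θ) = v i (Real.cos θ))
    (hper : ∀ i, Function.Periodic (g i) (4 * Real.pi)) :
    ∃ K, ∀ i, ∀ j k : ℕ, p * k < j → ((j : ℝ) + k) ^ r *
      |∫ x in (-1 : ℝ)..1, ω i x * chebT k (v i x) * chebT j x / √(1 - x ^ 2)| ≤ K := by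
  obtain ⟨K, hK⟩ := UniformlyCk.integral_cos_mul_cos_le hμ hμp h.regular.comp_cos hγ hg
    (fun i => h.abs_deriv_lift_le hCE (fun i => continuousOn_univ.1 (hγ.continuousOn i)) hg hcos i)
    (fun i θ => by
      show ω i (Real.cos (θ + 4 * Real.pi)) = ω i (Real.cos θ)
      rw [show θ + 4 * Real.pi = θ + 2 * Real.pi + 2 * Real.pi by ring, Real.cos_add_two_pi,
        Real.cos_add_two_pi]) hper
  refine ⟨K / 4, fun i j k hjk => ?_⟩
  have hcont : ContinuousOn (fun x => ω i x * chebT k (v i x) * chebT j x) (Icc (-1) 1) :=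
    ((h.regular.continuousOn i).mul ((continuous_chebT k).comp_continuousOn
      fun x hx => (h.hasDeriv i x hx).continuousWithinAt)).mul (continuous_chebT j).continuousOn
  have h1 := integral_comp_cos_eq hcont
  have h2 := hK i j k hjk
  simp only [← hcos, chebT_cos, mul_assoc] at h1
  rw [h1] at h2
  rw [integral_div_sqrt_one_sub_sq]
  simp only [← hcos, chebT_cos, mul_assoc]
  rw [abs_mul, abs_of_pos (by norm_num : (0 : ℝ) < 4)] at h2
  linarith

theorem exists_integral_bound (h : UniformBranches (r + 1) δ ℓ σ ω v) (hc : 0 < c)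
    (hcase : ∀ i, (∀ x ∈ Icc (-1 : ℝ) 1, c * ℓ i ≤ 1 + v i x ∧ c * ℓ i ≤ 1 - v i x) ∨
      ∃ β τ : ℝ, (β = 0 ∨ β = Real.pi) ∧ (τ = 1 ∨ τ = -1) ∧ v i (Real.cos β) = τ ∧
        ∀ x ∈ Icc (-1 : ℝ) 1, c * ℓ i ≤ 1 + τ * v i x)
    (hμ : 0 < μ) (hμp : μ < p)
    (hCE : ∀ i, ∀ x ∈ Ioo (-1 : ℝ) 1,
      √(1 - x ^ 2) * |σ i * ℓ i * ω i x| ≤ μ * √(1 - v i x ^ 2)) :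
    ∃ K, ∀ i, ∀ j k : ℕ, p * k < j → ((j : ℝ) + k) ^ (r + 1) *
      |∫ x in (-1 : ℝ)..1, ω i x * chebT k (v i x) * chebT j x / √(1 - x ^ 2)| ≤ K := by
  let P : ι → Prop := fun i => ∀ x ∈ Icc (-1 : ℝ) 1, c * ℓ i ≤ 1 + v i x ∧ c * ℓ i ≤ 1 - v i x
  obtain ⟨g, γ, h1, h2, h3, h4⟩ := (h.comp_index (Subtype.val : {i // P i} → ι)).exists_lift_of_away
    hc (fun i x hx => (i.2 x hx).1) (fun i x hx => (i.2 x hx).2)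
  obtain ⟨K₁, hK₁⟩ := (h.comp_index (Subtype.val : {i // P i} → ι)).exists_integral_bound_of_lift
    hμ hμp (fun i => hCE i) h1 h2 h3 h4
  choose β τ hβ hτ hv hx using fun i : {i // ¬ P i} => (hcase i).resolve_left i.2
  obtain ⟨g', γ', h1', h2', h3', h4'⟩ :=
    (h.comp_index (Subtype.val : {i // ¬ P i} → ι)).exists_lift_of_touching hc hβ hτ hv hx
  obtain ⟨K₂, hK₂⟩ := (h.comp_index (Subtype.val : {i // ¬ P i} → ι)).exists_integral_bound_of_lift
    hμ hμp (fun i => hCE i) h1' h2' h3' h4'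
  refine ⟨max K₁ K₂, fun i j k hjk => ?_⟩
  by_cases hi : P i
  · exact (hK₁ ⟨i, hi⟩ j k hjk).trans (le_max_left _ _)
  · exact (hK₂ ⟨i, hi⟩ j k hjk).trans (le_max_right _ _)

end UniformBranches

/-- Polynomial decay of the Chebyshev-basis transfer operator matrix
`L_{jk} = ((2-δ_{j0})/π) Σ_ι ∫_{-1}^1 |v_ι'| T_k(v_ι) T_j (1-x²)^{-1/2}` of a full-branch
Markov, uniformly C-expanding map of `[-1,1]` with inverse branches `v_ι` having branch
domains `O_ι = (a ι, b ι)`, satisfying distortion (DD_r) and partition spacing (P). -/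
theorem transfer_entry_bound_nonperiodic_differentiable
    {I : Type} [Countable I] (r : ℕ) (hr : 1 ≤ r)
    (a b : I → ℝ) (hab : ∀ i, a i < b i) (ha : ∀ i, -1 ≤ a i) (hb : ∀ i, b i ≤ 1)
    (hdisj : ∀ i j, i ≠ j → Disjoint (Set.Ioo (a i) (b i)) (Set.Ioo (a j) (b j)))
    (hfull : ∑' i, (b i - a i) = 2)
    (v : I → ℝ → ℝ)
    (hreg : ∀ i, ContDiffOn ℝ (r + 1 : ℕ) (v i) (Set.Icc (-1) 1))
    (hmono : ∀ i, StrictMonoOn (v i) (Set.Icc (-1) 1) ∨ StrictAntiOn (v i) (Set.Icc (-1) 1))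
    (himage : ∀ i, v i '' Set.Icc (-1) 1 = Set.Icc (a i) (b i))
    (C : ℕ → ℝ)
    (hC : ∀ n, 1 ≤ n → n ≤ r → ∀ i, ∀ x ∈ Set.Icc (-1 : ℝ) 1,
      |iteratedDerivWithin (n + 1) (v i) (Set.Icc (-1) 1) x| ≤
        C n * |derivWithin (v i) (Set.Icc (-1) 1) x|)
    (lam : ℝ) (hlam : 1 < lam)
    (hCE : ∀ i, ∀ x ∈ Set.Ioo (-1 : ℝ) 1,
      Real.sqrt (1 - x ^ 2) * |derivWithin (v i) (Set.Icc (-1) 1) x| ≤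
        lam⁻¹ * Real.sqrt (1 - v i x ^ 2))
    (Ξ : ℝ)
    (hΞ : ∀ i, ∀ σ ∈ ({-1, 1} : Set ℝ), σ ∉ Set.Icc (a i) (b i) →
      b i - a i ≤ Ξ * Metric.infDist σ (Set.Ioo (a i) (b i))) :
    ∀ p : ℝ, lam⁻¹ < p → p < 1 → ∃ Cb > (0 : ℝ), ∀ j k : ℕ,
      (k = 0 ∨ p < (j : ℝ) / (k : ℝ)) →
      |((2 - if j = 0 then 1 else 0) / Real.pi) *
          ∑' i, ∫ x in (-1 : ℝ)..1,
            |derivWithin (v i) (Set.Icc (-1) 1) x| * chebT k (v i x) * chebT j x /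
              Real.sqrt (1 - x ^ 2)| ≤
        Cb / (1 + ((j : ℝ) - p * (k : ℝ))) ^ r := by
  obtain ⟨r, rfl⟩ : ∃ n, r = n + 1 := ⟨r - 1, by omega⟩
  intro p hp hp1
  have hμ : 0 < lam⁻¹ := by positivity
  have hμ1 : lam⁻¹ < 1 := inv_lt_one_of_one_lt₀ hlam
  obtain ⟨δ, σ, ω, h, hω⟩ := exists_uniformBranches hr hab ha hb hreg hmono himage hC
  have hℓ : ∀ i, 0 < b i - a i := h.pos_length
  have hvI : ∀ i, ∀ x ∈ Set.Icc (-1 : ℝ) 1, v i x ∈ Set.Icc (a i) (b i) := fun i x hx =>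
    himage i ▸ Set.mem_image_of_mem _ hx
  have hl : (-1 : ℝ) ∈ Set.Icc (-1 : ℝ) 1 := by simp
  have hr1 : (1 : ℝ) ∈ Set.Icc (-1 : ℝ) 1 := by simp
  have hproper : ∀ i, ¬ (a i = -1 ∧ b i = 1) := by
    rintro i ⟨hai, hbi⟩
    refine abs_sub_ne_two_of_contracting hμ1 (hreg i).continuousOn (fun x hx =>
      (h.hasDeriv i x (Set.Ioo_subset_Icc_self hx)).hasDerivAt (Icc_mem_nhds hx.1 hx.2))
      (fun x hx => ?_) (fun x hx => by rw [← hω]; exact hCE i x hx) ?_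
    · have hx' := Set.Ioo_subset_Icc_self hx
      rcases hmono i with hm | hm
      · obtain ⟨h1, h2⟩ := hm.endpoints_of_image (himage i) (hab i).le
        rw [← hai, ← hbi, ← h1, ← h2]
        exact ⟨hm hl hx' hx.1, hm hx' hr1 hx.2⟩
      · obtain ⟨h1, h2⟩ := hm.endpoints_of_image (himage i) (hab i).le
        rw [← hai, ← hbi, ← h1, ← h2]
        exact ⟨hm hx' hr1 hx.2, hm hl hx' hx.1⟩
    · rcases hmono i with hm | hm
      · obtain ⟨h1, h2⟩ := hm.endpoints_of_image (himage i) (hab i).le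
        exact Or.inl ⟨h1.trans hai, h2.trans hbi⟩
      · obtain ⟨h1, h2⟩ := hm.endpoints_of_image (himage i) (hab i).le
        exact Or.inr ⟨h1.trans hbi, h2.trans hai⟩
  have hends : ∀ i, ∀ τ, τ = a i ∨ τ = b i →
      ∃ β, (β = 0 ∨ β = Real.pi) ∧ v i (Real.cos β) = τ := by
    intro i τ hτ
    have hend : (v i (-1) = a i ∧ v i 1 = b i) ∨ (v i (-1) = b i ∧ v i 1 = a i) :=
      (hmono i).imp (fun hm => hm.endpoints_of_image (himage i) (hab i).le)
        fun hm => hm.endpoints_of_image (himage i) (hab i).le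
    have : τ = v i 1 ∨ τ = v i (-1) := by
      rcases hend with ⟨h1, h2⟩ | ⟨h1, h2⟩ <;> rw [h1, h2] <;> tauto
    rcases this with h1 | h1
    · exact ⟨0, Or.inl rfl, by rw [Real.cos_zero, h1]⟩
    · exact ⟨Real.pi, Or.inr rfl, by rw [Real.cos_pi, h1]⟩
  have hc : 0 < (|Ξ| + 1)⁻¹ := by positivity
  have hleft : ∀ i, a i ≠ -1 → ∀ x ∈ Set.Icc (-1 : ℝ) 1,
      (|Ξ| + 1)⁻¹ * (b i - a i) ≤ 1 + v i x := by
    intro i hi x hx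
    have h1 := inv_mul_sub_le_abs_sub (hab i)
      (hΞ i (-1) (by simp) fun hmem => hi (le_antisymm hmem.1 (ha i))) (hvI i x hx)
    rwa [abs_of_nonpos (show -1 - v i x ≤ 0 by linarith [(h.mem_Icc i x hx).1]), neg_sub, sub_neg_eq_add,
      add_comm (v i x)] at h1
  have hright : ∀ i, b i ≠ 1 → ∀ x ∈ Set.Icc (-1 : ℝ) 1,
      (|Ξ| + 1)⁻¹ * (b i - a i) ≤ 1 - v i x := by
    intro i hi x hx
    have h1 := inv_mul_sub_le_abs_sub (hab i)
      (hΞ i 1 (by simp) fun hmem => hi (le_antisymm (hb i) hmem.2)) (hvI i x hx)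
    rwa [abs_of_nonneg (show 0 ≤ 1 - v i x by linarith [(h.mem_Icc i x hx).2])] at h1
  obtain ⟨K, hK⟩ := h.exists_integral_bound (p := p) hc (fun i => by
    by_cases hai : a i = -1
    · obtain ⟨β, hβ, hv⟩ := hends i (-1) (Or.inl hai.symm)
      refine Or.inr ⟨β, -1, hβ, Or.inr rfl, hv, fun x hx => ?_⟩
      have := hright i (fun hbi => hproper i ⟨hai, hbi⟩) x hx
      linarith
    by_cases hbi : b i = 1
    · obtain ⟨β, hβ, hv⟩ := hends i 1 (Or.inr hbi.symm)
      refine Or.inr ⟨β, 1, hβ, Or.inl rfl, hv, fun x hx => ?_⟩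
      have := hleft i hai x hx
      linarith
    exact Or.inl fun x hx => ⟨hleft i hai x hx, hright i hbi x hx⟩) hμ hp
    fun i x hx => by rw [← hω]; exact hCE i x hx
  have hsum : HasSum (fun i => b i - a i) 2 := by
    have : Summable fun i => b i - a i := by
      by_contra hn
      rw [tsum_eq_zero_of_not_summable hn] at hfull
      norm_num at hfull
    exact hfull ▸ this.hasSum
  have hintegral : ∀ i j k, ∫ x in (-1 : ℝ)..1, |derivWithin (v i) (Set.Icc (-1) 1) x| *
      chebT k (v i x) * chebT j x / Real.sqrt (1 - x ^ 2) = (b i - a i) *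
        ∫ x in (-1 : ℝ)..1, ω i x * chebT k (v i x) * chebT j x / Real.sqrt (1 - x ^ 2) := by
    intro i j k
    rw [← intervalIntegral.integral_const_mul]
    refine intervalIntegral.integral_congr fun x hx => ?_
    rw [Set.uIcc_of_le (by norm_num)] at hx
    have := h.pos_lower.trans_le (h.lower i x hx)
    simp only [hω, abs_mul, h.abs_sign, abs_of_pos (hℓ i), abs_of_pos this]
    ring
  simp only [hintegral]
  set J : I → ℕ → ℕ → ℝ := fun i j k =>
    ∫ x in (-1 : ℝ)..1, ω i x * chebT k (v i x) * chebT j x / Real.sqrt (1 - x ^ 2)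
  have hpre : ∀ j : ℕ, |(2 - if j = 0 then 1 else 0) / Real.pi| ≤ 1 := by
    intro j
    rw [abs_div, abs_of_pos Real.pi_pos, div_le_one Real.pi_pos]
    split_ifs <;> norm_num <;> linarith [Real.pi_gt_three]
  have hp0 : 0 < p := hμ.trans hp
  refine ⟨max 0 (2 * K * 2 ^ (r + 1)) + |∑' i, (b i - a i) * J i 0 0| + 1, by positivity,
    fun j k hjk => ?_⟩
  rw [abs_mul]
  refine (mul_le_of_le_one_left (abs_nonneg _) (hpre j)).trans ?_
  by_cases h0 : j = 0 ∧ k = 0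
  · obtain ⟨rfl, rfl⟩ := h0
    norm_num
    linarith [le_max_left 0 (2 * K * 2 ^ (r + 1))]
  have hlt : p * k < j := by
    rcases hjk with rfl | hjk
    · have : 0 < j := Nat.pos_of_ne_zero fun hj => h0 ⟨hj, rfl⟩
      simpa using this
    · rcases Nat.eq_zero_or_pos k with rfl | hk
      · simp at hjk
        linarith
      · exact (lt_div_iff₀ (by exact_mod_cast hk)).1 hjk
  have hj : 1 ≤ j := Nat.one_le_iff_ne_zero.2 fun hj => by
    rw [hj, Nat.cast_zero] at hlt
    exact absurd hlt (not_lt.2 (by positivity))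
  have hj' : (1 : ℝ) ≤ j := by exact_mod_cast hj
  have hpos : 0 < ((j : ℝ) + k) ^ (r + 1) := by positivity
  have hpos' : 0 < (1 + ((j : ℝ) - p * k)) ^ (r + 1) := pow_pos (by linarith) _
  have hterm : ∀ i, ‖(b i - a i) * J i j k‖ ≤ (b i - a i) * (K / ((j : ℝ) + k) ^ (r + 1)) := by
    intro i
    rw [Real.norm_eq_abs, abs_mul, abs_of_pos (hℓ i)]
    refine mul_le_mul_of_nonneg_left ?_ (hℓ i).le
    rw [le_div_iff₀' hpos]
    exact hK i j k hlt
  have htsum := tsum_of_norm_bounded (hsum.mul_right _) hterm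
  rw [Real.norm_eq_abs] at htsum
  refine htsum.trans ?_
  rw [le_div_iff₀ hpos']
  have hpow : (1 + ((j : ℝ) - p * k)) ^ (r + 1) ≤ 2 ^ (r + 1) * ((j : ℝ) + k) ^ (r + 1) := by
    rw [← mul_pow]
    refine pow_le_pow_left₀ (by linarith) ?_ _
    have : 0 ≤ p * (k : ℝ) := by positivity
    have : (0 : ℝ) ≤ k := by positivity
    linarith
  have hK' : 2 * (K / ((j : ℝ) + k) ^ (r + 1)) ≤
      max 0 (2 * K * 2 ^ (r + 1)) / 2 ^ (r + 1) / ((j : ℝ) + k) ^ (r + 1) := by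
    rw [← mul_div_assoc]
    refine div_le_div_of_nonneg_right ?_ hpos.le
    rw [le_div_iff₀ (by positivity)]
    exact le_max_right _ _
  calc _ ≤ max 0 (2 * K * 2 ^ (r + 1)) / 2 ^ (r + 1) / ((j : ℝ) + k) ^ (r + 1) *
        (2 ^ (r + 1) * ((j : ℝ) + k) ^ (r + 1)) := by
        refine mul_le_mul hK' hpow hpos'.le (by positivity)
    _ = max 0 (2 * K * 2 ^ (r + 1)) := by
        field_simp
    _ ≤ _ := by linarith [abs_nonneg (∑' i, (b i - a i) * J i 0 0)]
end

section
/- Let β ≥ 2 be an integer, λ > 1 and δ > 0. Let v : ℝ → ℝ satisfy v(x + 2πβ) = v(x) + 2π for all x and 0 < v'(x) ≤ λ⁻¹ for all real x, and suppose v extends to a holomorphic function on the closed strip {z ∈ ℂ : |Im z| ≤ δ} with v' nonvanishing there and sup_{|Im z| ≤ δ} |v''(z)/v'(z)| ≤ C_{1,δ} < ∞. Define the transfer operator on 2π-periodic functions by (Lφ)(x) = Σ_{b=0}^{β−1} v'(x + 2πb) φ(v(x + 2πb)). Then there exist C > 0 and ζ ∈ (0,δ] such that for every N ≥ 1 and every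 trigonometric polynomial φ of degree at most N: ‖Lφ − P_N(Lφ)‖_BV ≤ C · N^{3/2} e^{−ζN} · ‖φ‖_BV. -/
/-- The `j`-th Fourier coefficient of a `2π`-periodic function `φ : ℝ → ℂ`. -/
noncomputable def fCoeff (φ : ℝ → ℂ) (j : ℤ) : ℂ :=
  (1 / (2 * Real.pi) : ℂ) * ∫ x in (0 : ℝ)..(2 * Real.pi),
    φ x * Complex.exp (-Complex.I * (j : ℂ) * (x : ℂ))

/-- The `N`-th Fourier truncation `P_N φ = Σ_{|j| ≤ N} φ̂(j) e^{ijx}`. -/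
noncomputable def fTrunc (N : ℕ) (φ : ℝ → ℂ) : ℝ → ℂ := fun x =>
  ∑ j ∈ Finset.Icc (-(N : ℤ)) (N : ℤ), fCoeff φ j * Complex.exp (Complex.I * (j : ℂ) * (x : ℂ))

/-- The BV norm of a `2π`-periodic function:
`‖φ‖_BV = sup_{[0,2π]} |φ| + Var_{[0,2π]} φ`. -/
noncomputable def bvNorm (φ : ℝ → ℂ) : ℝ :=
  (⨆ x : Set.Icc (0 : ℝ) (2 * Real.pi), ‖φ (x : ℝ)‖) +
    (eVariationOn φ (Set.Icc 0 (2 * Real.pi))).toReal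

/-- The transfer operator `(L φ)(x) = Σ_{b=0}^{β-1} v'(x + 2πb) φ(v(x + 2πb))` of a
degree-`β` expanding circle map with inverse lift `v`. -/
noncomputable def transferOp (β : ℕ) (v : ℝ → ℝ) (φ : ℝ → ℂ) : ℝ → ℂ := fun x =>
  ∑ b ∈ Finset.range β,
    ((deriv v (x + 2 * Real.pi * b) : ℝ) : ℂ) * φ (v (x + 2 * Real.pi * b))

/-- `φ` is a trigonometric polynomial of degree at most `N`. -/
def IsTrigPoly (N : ℕ) (φ : ℝ → ℂ) : Prop :=
  ∃ c : ℤ → ℂ, φ = fun x : ℝ =>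
    ∑ j ∈ Finset.Icc (-(N : ℤ)) (N : ℤ), c j * Complex.exp (Complex.I * (j : ℂ) * (x : ℂ))

open Set Filter Topology

lemma norm_exp_I_int_mul_real (j : ℤ) (x : ℝ) :
    ‖Complex.exp (Complex.I * (j : ℂ) * (x : ℂ))‖ = 1 := by
  rw [Complex.norm_exp]; simp

lemma norm_exp_I_int_mul_real_sub_le (j : ℤ) (x y : ℝ) :
    ‖Complex.exp (Complex.I * (j : ℂ) * (x : ℂ)) - Complex.exp (Complex.I * (j : ℂ) * (y : ℂ))‖
      ≤ |(j : ℝ)| * |x - y| := by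
  have h : Complex.exp (Complex.I * (j : ℂ) * (x : ℂ)) - Complex.exp (Complex.I * (j : ℂ) * (y : ℂ))
      = Complex.exp (Complex.I * (j : ℂ) * (y : ℂ)) *
        (Complex.exp (Complex.I * ((j * (x - y) : ℝ) : ℂ)) - 1) := by
    rw [mul_sub, ← Complex.exp_add, mul_one]
    congr 2
    push_cast; ring
  rw [h, norm_mul, norm_exp_I_int_mul_real, one_mul]
  refine (Real.norm_exp_I_mul_ofReal_sub_one_le).trans ?_
  rw [Real.norm_eq_abs, abs_mul]

lemma summable_weighted_exp_neg_abs {t : ℝ} (ht : 0 < t) :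
    Summable fun j : ℤ => (1 + 2 * Real.pi * |(j : ℝ)|) * Real.exp (-t * |(j : ℝ)|) := by
  have key : Summable fun n : ℕ => (1 + 2 * Real.pi * (n : ℝ)) * Real.exp (-t * n) := by
    have h0 := Real.summable_pow_mul_exp_neg_nat_mul 0 ht
    have h1 := (Real.summable_pow_mul_exp_neg_nat_mul 1 ht).mul_left (2 * Real.pi)
    refine (h0.add h1).congr fun n => ?_
    ring
  apply Summable.of_nat_of_neg <;> simpa using key

lemma bvNorm_le_of_hasSum {g : ℝ → ℂ} {a : ℤ → ℂ} {B t : ℝ} (ht : 0 < t) (hB : 0 ≤ B)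
    (ha : ∀ j, ‖a j‖ ≤ B * Real.exp (-t * |(j : ℝ)|))
    (hg : ∀ x : ℝ, HasSum (fun j : ℤ => a j * Complex.exp (Complex.I * (j : ℂ) * (x : ℂ))) (g x)) :
    bvNorm g ≤ B * ∑' j : ℤ, (1 + 2 * Real.pi * |(j : ℝ)|) * Real.exp (-t * |(j : ℝ)|) := by
  have hw := summable_weighted_exp_neg_abs ht
  have hpi := Real.pi_pos
  have hsum0 : Summable fun j : ℤ => Real.exp (-t * |(j : ℝ)|) := by
    refine hw.of_nonneg_of_le (fun j => (Real.exp_pos _).le) fun j => ?_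
    nlinarith [Real.exp_pos (-t * |(j : ℝ)|),
      mul_nonneg (mul_nonneg hpi.le (abs_nonneg (j : ℝ))) (Real.exp_pos (-t * |(j : ℝ)|)).le]
  have hsum1 : Summable fun j : ℤ => |(j : ℝ)| * Real.exp (-t * |(j : ℝ)|) := by
    refine ((hw.sub hsum0).mul_left (2 * Real.pi)⁻¹).congr fun j => ?_
    field_simp
    ring
  set T0 := ∑' j : ℤ, Real.exp (-t * |(j : ℝ)|)
  set T1 := ∑' j : ℤ, |(j : ℝ)| * Real.exp (-t * |(j : ℝ)|)
  have hT : ∑' j : ℤ, (1 + 2 * Real.pi * |(j : ℝ)|) * Real.exp (-t * |(j : ℝ)|)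
      = T0 + 2 * Real.pi * T1 := by
    rw [← tsum_mul_left, ← hsum0.tsum_add (hsum1.mul_left _)]
    exact tsum_congr fun j => by ring
  have hT0 : 0 ≤ T0 := tsum_nonneg fun j => (Real.exp_pos _).le
  have hT1 : 0 ≤ T1 := tsum_nonneg fun j => by positivity
  have hsup : ∀ x, ‖g x‖ ≤ B * T0 := fun x =>
    (hg x).norm_le_of_bounded (hsum0.hasSum.mul_left B) fun j => by
      rw [norm_mul, norm_exp_I_int_mul_real, mul_one]; exact ha j
  have hlip : ∀ x y, ‖g x - g y‖ ≤ B * T1 * |x - y| := fun x y => by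
    refine ((hg x).sub (hg y)).norm_le_of_bounded
      ((hsum1.hasSum.mul_left B).mul_right |x - y|) fun j => ?_
    rw [← mul_sub, norm_mul]
    calc _ ≤ (B * Real.exp (-t * |(j : ℝ)|)) * (|(j : ℝ)| * |x - y|) :=
          mul_le_mul (ha j) (norm_exp_I_int_mul_real_sub_le j x y) (norm_nonneg _) (by positivity)
      _ = _ := by ring
  have hL : LipschitzWith (B * T1).toNNReal g := LipschitzWith.of_dist_le_mul fun x y => by
    rw [dist_eq_norm, Real.dist_eq, Real.coe_toNNReal _ (by positivity)]
    exact hlip x y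
  have hvar : eVariationOn g (Icc 0 (2 * Real.pi)) ≤ ENNReal.ofReal (B * T1 * (2 * Real.pi)) := by
    have h1 := (hL.lipschitzOnWith (s := univ)).comp_eVariationOn_le (g := id)
      (mapsTo_univ _ (Icc 0 (2 * Real.pi)))
    have h2 := (monotone_id.monotoneOn (Icc (0 : ℝ) (2 * Real.pi))).eVariationOn_eq
      (left_mem_Icc.2 (by positivity)) (right_mem_Icc.2 (by positivity))
    rw [inter_self] at h2
    refine h1.trans ((mul_le_mul_right h2.le _).trans ?_)
    rw [ENNReal.ofReal_mul (by positivity)]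
    simp [ENNReal.ofReal]
  have : Nonempty (Icc (0 : ℝ) (2 * Real.pi)) := ⟨⟨0, by simp [hpi.le]⟩⟩
  have hv : (eVariationOn g (Icc 0 (2 * Real.pi))).toReal ≤ B * T1 * (2 * Real.pi) :=
    ENNReal.toReal_le_of_le_ofReal (by positivity) hvar
  calc bvNorm g ≤ B * T0 + B * T1 * (2 * Real.pi) := add_le_add (ciSup_le fun x => hsup x) hv
    _ = _ := by rw [hT]; ring

lemma hasSum_fCoeff {f : ℝ → ℂ} (hf : Continuous f) (hper : Function.Periodic f (2 * Real.pi))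
    (hs : Summable (fCoeff f)) (x : ℝ) :
    HasSum (fun j : ℤ => fCoeff f j * Complex.exp (Complex.I * (j : ℂ) * (x : ℂ))) (f x) := by
  have : Fact (0 < 2 * Real.pi) := ⟨by positivity⟩
  let F : C(AddCircle (2 * Real.pi), ℂ) :=
    ⟨hper.lift, continuous_coinduced_dom.mpr (by exact hf)⟩
  have hF : ∀ y : ℝ, F (y : AddCircle (2 * Real.pi)) = f y := fun y => rfl
  have hpi : (Real.pi : ℂ) ≠ 0 := by exact_mod_cast Real.pi_ne_zero
  have hcoef : fourierCoeff F = fCoeff f := by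
    ext j
    rw [fourierCoeff_eq_intervalIntegral F j 0, fCoeff, zero_add, Complex.real_smul]
    congr 1
    · push_cast; rfl
    · refine intervalIntegral.integral_congr fun y _ => ?_
      simp only [hF, smul_eq_mul]
      rw [fourier_coe_apply, mul_comm]
      congr 2
      push_cast
      field_simp
  have h := has_pointwise_sum_fourier_series_of_summable (f := F) (by rwa [hcoef])
    (x : AddCircle (2 * Real.pi))
  rw [hcoef, hF] at h
  convert h using 2 with j
  rw [smul_eq_mul, fourier_coe_apply]
  congr 2
  push_cast
  field_simp

lemma bvNorm_sub_fTrunc_le {f : ℝ → ℂ} (hf : Continuous f)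
    (hper : Function.Periodic f (2 * Real.pi)) {A s t : ℝ} (hA : 0 ≤ A) (hs : 0 < s) (ht : 0 < t)
    (hdecay : ∀ j : ℤ, ‖fCoeff f j‖ ≤ A * Real.exp (-(s + t) * |(j : ℝ)|)) (N : ℕ) :
    bvNorm (fun x => f x - fTrunc N f x) ≤ A * Real.exp (-s * N) *
      ∑' j : ℤ, (1 + 2 * Real.pi * |(j : ℝ)|) * Real.exp (-t * |(j : ℝ)|) := by
  have hsm : Summable (fCoeff f) := by
    refine Summable.of_norm_bounded
      ((summable_weighted_exp_neg_abs (add_pos hs ht)).mul_left A) fun j => ?_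
    refine (hdecay j).trans (mul_le_mul_of_nonneg_left ?_ hA)
    refine le_mul_of_one_le_left (Real.exp_pos _).le ?_
    have := mul_nonneg (mul_nonneg zero_le_two Real.pi_pos.le) (abs_nonneg (j : ℝ))
    linarith
  refine bvNorm_le_of_hasSum
    (a := fun j => if j ∈ Finset.Icc (-(N : ℤ)) N then 0 else fCoeff f j)
    ht (by positivity) (fun j => ?_) fun x => ?_
  · split_ifs with hj
    · rw [norm_zero]; positivity
    · have hN : (N : ℝ) ≤ |(j : ℝ)| := by
        have : (N : ℤ) ≤ |j| := by
          rw [Finset.mem_Icc, ← abs_le] at hj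
          exact (not_le.1 hj).le
        exact_mod_cast this
      refine (hdecay j).trans ?_
      rw [mul_assoc, ← Real.exp_add]
      refine mul_le_mul_of_nonneg_left (Real.exp_le_exp.2 ?_) hA
      nlinarith
  · have h1 := hasSum_fCoeff hf hper hsm x
    have h2 : HasSum (fun j : ℤ => if j ∈ Finset.Icc (-(N : ℤ)) N then
        fCoeff f j * Complex.exp (Complex.I * (j : ℂ) * (x : ℂ)) else 0) (fTrunc N f x) := by
      have := hasSum_sum_of_ne_finset_zero (L := SummationFilter.unconditional ℤ) (s := Finset.Icc (-(N : ℤ)) N)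
        (f := fun j : ℤ => if j ∈ Finset.Icc (-(N : ℤ)) N then
          fCoeff f j * Complex.exp (Complex.I * (j : ℂ) * (x : ℂ)) else 0)
        fun j hj => if_neg hj
      rwa [Finset.sum_congr rfl fun j hj => if_pos hj] at this
    refine (h1.sub h2).congr_fun fun j => ?_
    split_ifs <;> simp

lemma norm_fCoeff_le {φ : ℝ → ℂ} {S : ℝ} (hS : ∀ x ∈ Icc 0 (2 * Real.pi), ‖φ x‖ ≤ S) (j : ℤ) :
    ‖fCoeff φ j‖ ≤ S := by
  have hpi := Real.pi_pos
  have h := intervalIntegral.norm_integral_le_of_norm_le_const (a := 0) (b := 2 * Real.pi) (C := S)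
    (f := fun x : ℝ => φ x * Complex.exp (-Complex.I * (j : ℂ) * (x : ℂ))) fun x hx => by
      rw [uIoc_of_le (by positivity)] at hx
      have : ‖Complex.exp (-Complex.I * (j : ℂ) * (x : ℂ))‖ = 1 := by
        rw [Complex.norm_exp]; simp
      rw [norm_mul, this, mul_one]
      exact hS x (Ioc_subset_Icc_self hx)
  rw [fCoeff, norm_mul]
  have h1 : ‖(1 / (2 * Real.pi) : ℂ)‖ = (2 * Real.pi)⁻¹ := by
    simp [abs_of_pos hpi]
  rw [h1]
  rw [sub_zero, abs_of_pos (by positivity)] at h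
  calc _ ≤ (2 * Real.pi)⁻¹ * (S * (2 * Real.pi)) := by gcongr
    _ = S := by field_simp

lemma integral_exp_int (k : ℤ) :
    ∫ x in (0 : ℝ)..(2 * Real.pi), Complex.exp (Complex.I * (k : ℂ) * (x : ℂ))
      = if k = 0 then 2 * (Real.pi : ℂ) else 0 := by
  split_ifs with hk
  · simp [hk]
  · rw [integral_exp_mul_complex (by simp [hk])]
    have : Complex.exp (Complex.I * (k : ℂ) * ((2 * Real.pi : ℝ) : ℂ)) = 1 := by
      rw [Complex.exp_eq_one_iff]
      exact ⟨k, by push_cast; ring⟩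
    rw [this]; simp

lemma fCoeff_trigPoly (N : ℕ) (c : ℤ → ℂ) {k : ℤ} (hk : k ∈ Finset.Icc (-(N : ℤ)) N) :
    fCoeff (fun x : ℝ => ∑ j ∈ Finset.Icc (-(N : ℤ)) (N : ℤ),
      c j * Complex.exp (Complex.I * (j : ℂ) * (x : ℂ))) k = c k := by
  have hpi : (Real.pi : ℂ) ≠ 0 := by exact_mod_cast Real.pi_ne_zero
  have h : ∀ x : ℝ, (∑ j ∈ Finset.Icc (-(N : ℤ)) (N : ℤ),
      c j * Complex.exp (Complex.I * (j : ℂ) * (x : ℂ))) *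
        Complex.exp (-Complex.I * (k : ℂ) * (x : ℂ)) = ∑ j ∈ Finset.Icc (-(N : ℤ)) (N : ℤ),
      c j * Complex.exp (Complex.I * ((j - k : ℤ) : ℂ) * (x : ℂ)) := fun x => by
    rw [Finset.sum_mul]
    refine Finset.sum_congr rfl fun j _ => ?_
    rw [mul_assoc, ← Complex.exp_add]
    congr 2
    push_cast; ring
  rw [fCoeff]
  simp_rw [h]
  rw [intervalIntegral.integral_finsetSum fun j _ =>
    (Continuous.intervalIntegrable (by fun_prop) _ _)]
  simp_rw [intervalIntegral.integral_const_mul, integral_exp_int, sub_eq_zero]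
  simp only [mul_ite, mul_zero, Finset.sum_ite_eq', hk, if_true]
  field_simp

lemma norm_le_bvNorm {φ : ℝ → ℂ} (hφ : Continuous φ) {x : ℝ} (hx : x ∈ Icc 0 (2 * Real.pi)) :
    ‖φ x‖ ≤ bvNorm φ := by
  have hb : BddAbove (range fun x : Icc (0 : ℝ) (2 * Real.pi) => ‖φ (x : ℝ)‖) :=
    isCompact_range (by fun_prop) |>.bddAbove
  exact (le_ciSup hb ⟨x, hx⟩).trans (le_add_of_nonneg_right ENNReal.toReal_nonneg)

/-- A trigonometric polynomial with coefficients bounded by `S`, on the strip `|Im z| ≤ h`. -/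
lemma norm_trigPoly_complex_le {N : ℕ} {c : ℤ → ℂ} {S : ℝ}
    (hc : ∀ j ∈ Finset.Icc (-(N : ℤ)) (N : ℤ), ‖c j‖ ≤ S) {z : ℂ} {h : ℝ} (hz : |z.im| ≤ h) :
    ‖∑ j ∈ Finset.Icc (-(N : ℤ)) (N : ℤ), c j * Complex.exp (Complex.I * (j : ℂ) * z)‖
      ≤ (2 * N + 1) * (S * Real.exp (N * h)) := by
  have hterm : ∀ j ∈ Finset.Icc (-(N : ℤ)) (N : ℤ),
      ‖c j * Complex.exp (Complex.I * (j : ℂ) * z)‖ ≤ S * Real.exp (N * h) := fun j hj => by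
    have hS : 0 ≤ S := (norm_nonneg _).trans (hc j hj)
    rw [norm_mul, Complex.norm_exp]
    refine mul_le_mul (hc j hj) (Real.exp_le_exp.2 ?_) (Real.exp_pos _).le hS
    have hj' : |(j : ℝ)| ≤ N := by
      rw [Finset.mem_Icc, ← abs_le] at hj
      exact_mod_cast hj
    calc (Complex.I * (j : ℂ) * z).re = -(j * z.im) := by simp
      _ ≤ |(j : ℝ)| * |z.im| := by rw [← abs_mul]; exact neg_le_abs _
      _ ≤ N * h := mul_le_mul hj' hz (abs_nonneg _) (Nat.cast_nonneg _)
  refine (norm_sum_le_of_le _ hterm).trans_eq ?_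
  rw [Finset.sum_const, Int.card_Icc, nsmul_eq_mul]
  congr 1
  have : ((N : ℤ) + 1 - -(N : ℤ)).toNat = 2 * N + 1 := by omega
  rw [this]; push_cast; ring

lemma isOpen_strip (δ : ℝ) : IsOpen {z : ℂ | |z.im| < δ} :=
  isOpen_lt (by fun_prop) continuous_const

lemma convex_strip (δ : ℝ) : Convex ℝ {z : ℂ | |z.im| < δ} := by
  have h : {z : ℂ | |z.im| < δ} = Complex.imLm ⁻¹' Ioo (-δ) δ := by
    ext z; simp [abs_lt]
  rw [h]
  exact (convex_Ioo _ _).linear_preimage _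

lemma periodic_on_strip {F : ℂ → ℂ} {δ p : ℝ} (hδ : 0 < δ)
    (hF : DifferentiableOn ℂ F {z : ℂ | |z.im| < δ})
    (hper : ∀ x : ℝ, F (x + p) = F x) {z : ℂ} (hz : |z.im| < δ) : F (z + p) = F z := by
  have hG : DifferentiableOn ℂ (fun z => F (z + p)) {z : ℂ | |z.im| < δ} :=
    hF.comp (by fun_prop) fun z hz => by simpa using hz
  refine AnalyticOnNhd.eqOn_of_preconnected_of_frequently_eq
    (hG.analyticOnNhd (isOpen_strip δ)) (hF.analyticOnNhd (isOpen_strip δ))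
    (convex_strip δ).isPreconnected (z₀ := 0) (by simpa using hδ) ?_ hz
  have ht : Tendsto (fun x : ℝ => (x : ℂ)) (𝓝[≠] 0) (𝓝[≠] 0) := by
    refine tendsto_nhdsWithin_iff.2 ⟨?_, ?_⟩
    · exact (Complex.continuous_ofReal.tendsto' 0 0 (by simp)).mono_left nhdsWithin_le_nhds
    · filter_upwards [self_mem_nhdsWithin] with x hx
      simpa using hx
  exact ht.frequently (Eventually.of_forall hper).frequently

/-- Shifting the contour of a periodic holomorphic integrand. -/
lemma integral_eq_integral_shift {G : ℂ → ℂ} {δ p y : ℝ}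
    (hG : DifferentiableOn ℂ G {z : ℂ | |z.im| < δ})
    (hper : ∀ z : ℂ, |z.im| < δ → G (z + p) = G z) (hy : |y| < δ) :
    ∫ x in (0 : ℝ)..p, G x = ∫ x in (0 : ℝ)..p, G (x + y * Complex.I) := by
  have h := Complex.integral_boundary_rect_eq_zero_of_differentiableOn G 0 (p + y * Complex.I)
    (hG.mono fun z hz => by
      have hz2 := (Complex.mem_reProdIm.1 hz).2
      simp only [Complex.zero_im, Complex.add_im, Complex.ofReal_im, Complex.mul_im,
        Complex.ofReal_re, Complex.I_im, Complex.I_re, mul_one, mul_zero, add_zero, zero_add] at hz2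
      have := abs_sub_left_of_mem_uIcc hz2
      simp only [sub_zero] at this
      exact this.trans_lt hy)
  have hside : ∫ t in (0 : ℝ)..y, G (p + t * Complex.I) = ∫ t in (0 : ℝ)..y, G (t * Complex.I) := by
    refine intervalIntegral.integral_congr fun t ht => ?_
    have := abs_sub_left_of_mem_uIcc ht
    simp only [sub_zero] at this
    simpa [add_comm] using hper (t * Complex.I) (by simpa using this.trans_lt hy)
  simp [hside] at h
  exact sub_eq_zero.1 h

lemma norm_fCoeff_le_of_holomorphic {F : ℂ → ℂ} {δ r B : ℝ} (hr : 0 < r) (hrδ : r < δ)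
    (hF : DifferentiableOn ℂ F {z : ℂ | |z.im| < δ})
    (hper : ∀ x : ℝ, F (x + (2 * Real.pi : ℝ)) = F x)
    (hB : ∀ z : ℂ, |z.im| ≤ r → ‖F z‖ ≤ B) (j : ℤ) :
    ‖fCoeff (fun x => F x) j‖ ≤ B * Real.exp (-r * |(j : ℝ)|) := by
  have hpi := Real.pi_pos
  set G : ℂ → ℂ := fun z => F z * Complex.exp (-Complex.I * (j : ℂ) * z) with hGdef
  have hG : DifferentiableOn ℂ G {z : ℂ | |z.im| < δ} := hF.mul (by fun_prop)
  have hGper : ∀ z : ℂ, |z.im| < δ → G (z + (2 * Real.pi : ℝ)) = G z := fun z hz => by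
    simp only [hGdef]
    rw [periodic_on_strip (hr.trans hrδ) hF hper hz]
    congr 1
    rw [Complex.exp_eq_exp_iff_exists_int]
    exact ⟨-j, by push_cast; ring⟩
  obtain ⟨y, hy, hyj⟩ : ∃ y : ℝ, |y| = r ∧ (j : ℝ) * y = -r * |(j : ℝ)| := by
    rcases le_total 0 (j : ℝ) with h | h
    · exact ⟨-r, by rw [abs_neg, abs_of_pos hr], by rw [abs_of_nonneg h]; ring⟩
    · exact ⟨r, abs_of_pos hr, by rw [abs_of_nonpos h]; ring⟩
  have hint : ‖∫ x in (0 : ℝ)..(2 * Real.pi), G x‖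
      ≤ B * Real.exp (-r * |(j : ℝ)|) * (2 * Real.pi) := by
    rw [integral_eq_integral_shift hG hGper (hy.trans_lt hrδ)]
    refine (intervalIntegral.norm_integral_le_of_norm_le_const
      (C := B * Real.exp (-r * |(j : ℝ)|)) fun x _ => ?_).trans_eq ?_
    · rw [hGdef, norm_mul]
      have he : ‖Complex.exp (-Complex.I * (j : ℂ) * (x + y * Complex.I))‖
          = Real.exp (-r * |(j : ℝ)|) := by
        rw [Complex.norm_exp, ← hyj]; simp
      rw [he]
      exact mul_le_mul_of_nonneg_right (hB _ (by simp [hy])) (Real.exp_pos _).le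
    · rw [sub_zero, abs_of_pos (mul_pos two_pos hpi)]
  rw [fCoeff, norm_mul]
  have h1 : ‖(1 / (2 * Real.pi) : ℂ)‖ = (2 * Real.pi)⁻¹ := by
    simp [abs_of_pos hpi]
  rw [h1]
  calc _ ≤ (2 * Real.pi)⁻¹ * (B * Real.exp (-r * |(j : ℝ)|) * (2 * Real.pi)) := by gcongr
    _ = _ := by field_simp

lemma differentiableOn_deriv_strip {V : ℂ → ℂ} {δ : ℝ}
    (hV : DifferentiableOn ℂ V {z : ℂ | |z.im| < δ}) :
    DifferentiableOn ℂ (deriv V) {z : ℂ | |z.im| < δ} :=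
  hV.deriv (isOpen_strip δ)

/-- Bounded distortion propagates a bound on the derivative from the real axis to a strip. -/
lemma norm_deriv_strip_le {V : ℂ → ℂ} {δ C κ r : ℝ} (hrδ : r < δ) (hC : 0 ≤ C)
    (hV : DifferentiableOn ℂ V {z : ℂ | |z.im| < δ})
    (hAD : ∀ z : ℂ, |z.im| < δ → ‖deriv (deriv V) z‖ ≤ C * ‖deriv V z‖)
    (hreal : ∀ x : ℝ, ‖deriv V x‖ ≤ κ) {z : ℂ} (hz : |z.im| ≤ r) :
    ‖deriv V z‖ ≤ κ * Real.exp (C * r) := by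
  let p : ℝ → ℂ := fun t => z.re + t * (z.im * Complex.I)
  have hp : ∀ t ∈ Icc (0 : ℝ) 1, |(p t).im| < δ := fun t ht => by
    have : (p t).im = t * z.im := by simp [p]
    rw [this, abs_mul, abs_of_nonneg ht.1]
    exact (mul_le_of_le_one_left (abs_nonneg _) ht.2).trans_lt (hz.trans_lt hrδ)
  have hder : ∀ t ∈ Icc (0 : ℝ) 1, HasDerivAt (fun t => deriv V (p t))
      (deriv (deriv V) (p t) * (z.im * Complex.I)) t := fun t ht => by
    have h1 := ((differentiableOn_deriv_strip hV).differentiableAt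
      ((isOpen_strip δ).mem_nhds (hp t ht))).hasDerivAt
    have h2 : HasDerivAt p (z.im * Complex.I) t := by
      simp only [p, hasDerivAt_const_add_iff]
      simpa using ((Complex.ofRealCLM.hasDerivAt (x := t)).mul_const
        ((z.im : ℂ) * Complex.I))
    exact h1.comp t h2
  have h := norm_le_gronwallBound_of_norm_deriv_right_le (δ := κ) (K := C * r) (ε := 0)
    (fun t ht => (hder t ht).continuousAt.continuousWithinAt)
    (fun t ht => (hder t (Ico_subset_Icc_self ht)).hasDerivWithinAt)
    (by simpa [p] using hreal z.re)
    (fun t ht => by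
      rw [norm_mul, add_zero]
      calc _ ≤ (C * ‖deriv V (p t)‖) * r :=
            mul_le_mul (hAD _ (hp t (Ico_subset_Icc_self ht))) (by simpa using hz)
              (norm_nonneg _) (by positivity)
        _ = _ := by ring) 1 (right_mem_Icc.2 zero_le_one)
  rw [gronwallBound_ε0, sub_zero, mul_one] at h
  have hp1 : p 1 = z := by simp [p, Complex.re_add_im]
  rwa [hp1] at h

lemma abs_im_le_on_strip {V : ℂ → ℂ} {δ κ r : ℝ} (hr : 0 ≤ r) (hrδ : r < δ)
    (hV : DifferentiableOn ℂ V {z : ℂ | |z.im| < δ}) (hreal : ∀ x : ℝ, (V x).im = 0)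
    (hκ : ∀ z : ℂ, |z.im| ≤ r → ‖deriv V z‖ ≤ κ) {z : ℂ} (hz : |z.im| ≤ r) :
    |(V z).im| ≤ κ * r := by
  have hconv : Convex ℝ {z : ℂ | |z.im| ≤ r} := by
    have h : {z : ℂ | |z.im| ≤ r} = Complex.imLm ⁻¹' Icc (-r) r := by
      ext z; simp [abs_le]
    rw [h]
    exact (convex_Icc _ _).linear_preimage _
  have h := hconv.norm_image_sub_le_of_norm_deriv_le (f := V)
    (fun w hw => hV.differentiableAt ((isOpen_strip δ).mem_nhds (lt_of_le_of_lt hw hrδ))) hκ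
    (x := (z.re : ℂ)) (y := z) (show |(z.re : ℂ).im| ≤ r by simpa using hr) hz
  have hκ0 : 0 ≤ κ := (norm_nonneg _).trans (hκ 0 (by simpa using hr))
  have hzre : ‖z - z.re‖ = |z.im| := by
    have : z - z.re = z.im * Complex.I := by
      nth_rewrite 1 [← Complex.re_add_im z]; ring
    rw [this]; simp
  calc |(V z).im| = |(V z - V z.re).im| := by rw [Complex.sub_im, hreal, sub_zero]
    _ ≤ ‖V z - V z.re‖ := Complex.abs_im_le_norm _
    _ ≤ κ * ‖z - z.re‖ := h
    _ ≤ κ * r := by rw [hzre]; gcongr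

lemma transferOp_periodic {β : ℕ} {v : ℝ → ℝ} {φ : ℝ → ℂ}
    (hlift : ∀ x : ℝ, v (x + 2 * Real.pi * β) = v x + 2 * Real.pi)
    (hφ : Function.Periodic φ (2 * Real.pi)) :
    Function.Periodic (transferOp β v φ) (2 * Real.pi) := fun x => by
  have hderiv : deriv v (x + 2 * Real.pi * β) = deriv v x := by
    rw [← deriv_comp_add_const, funext hlift, deriv_add_const]
  let g : ℕ → ℂ := fun b =>
    ((deriv v (x + 2 * Real.pi * b) : ℝ) : ℂ) * φ (v (x + 2 * Real.pi * b))
  have hg : g β = g 0 := by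
    simp only [g, hderiv, hlift, hφ _]
    simp
  have h1 : transferOp β v φ (x + 2 * Real.pi) = ∑ b ∈ Finset.range β, g (b + 1) := by
    refine Finset.sum_congr rfl fun b _ => ?_
    have : x + 2 * Real.pi + 2 * Real.pi * b = x + 2 * Real.pi * (b + 1 : ℕ) := by
      push_cast; ring
    simp only [g, this]
  have h2 := (Finset.sum_range_succ' g β).symm.trans (Finset.sum_range_succ g β)
  rw [hg] at h2
  rw [h1]
  exact add_right_cancel h2

lemma deriv_real_of_holomorphic_extension {V : ℂ → ℂ} {v : ℝ → ℝ} {x : ℝ}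
    (hVv : ∀ x : ℝ, V x = (v x : ℂ)) (hV : DifferentiableAt ℂ V x) :
    deriv V x = ((deriv v x : ℝ) : ℂ) := by
  have h1 : HasDerivAt (fun y : ℝ => (V y).re) (deriv V x).re x := hV.hasDerivAt.real_of_complex
  have h2 : HasDerivAt v (deriv V x).re x := by simpa [hVv] using h1
  have h3 := h2.ofReal_comp
  have h4 : HasDerivAt (fun y : ℝ => (v y : ℂ)) (deriv V x) x := by
    simpa only [hVv] using hV.hasDerivAt.comp_ofReal
  rw [h2.deriv]
  exact h4.unique h3

/-- The truncation estimate for an inverse lift which contracts a strip by a factor `κ < 1`. -/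
lemma bvNorm_transferOp_sub_fTrunc_le {β : ℕ} {v : ℝ → ℝ} {V : ℂ → ℂ} {δ κ r : ℝ}
    (hr : 0 < r) (hrδ : r < δ) (hκ1 : κ < 1)
    (hlift : ∀ x : ℝ, v (x + 2 * Real.pi * β) = v x + 2 * Real.pi)
    (hVv : ∀ x : ℝ, V x = (v x : ℂ))
    (hV : DifferentiableOn ℂ V {z : ℂ | |z.im| < δ})
    (hκ : ∀ z : ℂ, |z.im| ≤ r → ‖deriv V z‖ ≤ κ)
    {N : ℕ} {φ : ℝ → ℂ} (hφ : IsTrigPoly N φ) :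
    bvNorm (fun x => transferOp β v φ x - fTrunc N (transferOp β v φ) x) ≤
      β * ((2 * N + 1) * (bvNorm φ * Real.exp (N * (κ * r)))) *
        Real.exp (-(r * (1 + κ) / 2) * N) *
        ∑' j : ℤ, (1 + 2 * Real.pi * |(j : ℝ)|) * Real.exp (-(r * (1 - κ) / 2) * |(j : ℝ)|) := by
  obtain ⟨c, rfl⟩ := hφ
  set φ : ℝ → ℂ := fun x : ℝ =>
    ∑ j ∈ Finset.Icc (-(N : ℤ)) (N : ℤ), c j * Complex.exp (Complex.I * (j : ℂ) * (x : ℂ))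
    with hφdef
  have hκ0 : 0 ≤ κ := (norm_nonneg _).trans (hκ 0 (by simpa using hr.le))
  have hφcont : Continuous φ := by fun_prop
  have hφper : Function.Periodic φ (2 * Real.pi) := fun x => by
    refine Finset.sum_congr rfl fun j _ => ?_
    congr 1
    rw [Complex.exp_eq_exp_iff_exists_int]
    exact ⟨j, by push_cast; ring⟩
  have hc : ∀ j ∈ Finset.Icc (-(N : ℤ)) (N : ℤ), ‖c j‖ ≤ bvNorm φ := fun j hj => by
    rw [← fCoeff_trigPoly N c hj]
    exact norm_fCoeff_le (fun x hx => norm_le_bvNorm hφcont hx) j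
  have hS : 0 ≤ bvNorm φ :=
    (norm_nonneg _).trans (norm_le_bvNorm hφcont (left_mem_Icc.2 (by positivity)))
  let Φ : ℂ → ℂ := fun z =>
    ∑ j ∈ Finset.Icc (-(N : ℤ)) (N : ℤ), c j * Complex.exp (Complex.I * (j : ℂ) * z)
  let F : ℂ → ℂ := fun z => ∑ b ∈ Finset.range β,
    deriv V (z + (2 * Real.pi * b : ℝ)) * Φ (V (z + (2 * Real.pi * b : ℝ)))
  have hΦ : Differentiable ℂ Φ := by fun_prop
  have hmaps : ∀ b : ℕ, MapsTo (fun z : ℂ => z + (2 * Real.pi * b : ℝ))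
      {z : ℂ | |z.im| < δ} {z : ℂ | |z.im| < δ} := fun b z hz => by
    rw [mem_ofPred_eq, Complex.add_im, Complex.ofReal_im, add_zero]
    exact hz
  have hF : DifferentiableOn ℂ F {z : ℂ | |z.im| < δ} := by
    refine DifferentiableOn.fun_sum fun b _ => DifferentiableOn.mul ?_ ?_
    · exact (differentiableOn_deriv_strip hV).comp (by fun_prop) (hmaps b)
    · exact hΦ.comp_differentiableOn (hV.comp (by fun_prop) (hmaps b))
  have hreal : ∀ x : ℝ, F x = transferOp β v φ x := fun x => by
    refine Finset.sum_congr rfl fun b _ => ?_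
    rw [← Complex.ofReal_add, hVv, deriv_real_of_holomorphic_extension hVv
      (hV.differentiableAt ((isOpen_strip δ).mem_nhds (by simpa using hr.trans hrδ)))]
  have hper := transferOp_periodic hlift hφper
  have hcont : Continuous (transferOp β v φ) := by
    rw [← funext hreal]
    exact hF.continuousOn.comp_continuous Complex.continuous_ofReal
      fun x => by simpa using hr.trans hrδ
  have hB : ∀ z : ℂ, |z.im| ≤ r →
      ‖F z‖ ≤ β * ((2 * N + 1) * (bvNorm φ * Real.exp (N * (κ * r)))) := fun z hz => by
    refine (norm_sum_le_of_le (f := fun b : ℕ => deriv V (z + (2 * Real.pi * b : ℝ)) *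
      Φ (V (z + (2 * Real.pi * b : ℝ)))) _ fun b _ => ?_).trans_eq
      (by rw [Finset.sum_const, Finset.card_range, nsmul_eq_mul])
    have hzb : |(z + (2 * Real.pi * b : ℝ)).im| ≤ r := by
      rwa [Complex.add_im, Complex.ofReal_im, add_zero]
    rw [norm_mul]
    refine (mul_le_of_le_one_left (norm_nonneg _) ((hκ _ hzb).trans hκ1.le)).trans ?_
    exact norm_trigPoly_complex_le hc
      (abs_im_le_on_strip hr.le hrδ hV (fun x => by rw [hVv, Complex.ofReal_im]) hκ hzb)
  refine bvNorm_sub_fTrunc_le hcont hper (by positivity) (by positivity)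
    (half_pos (mul_pos hr (sub_pos.2 hκ1))) (fun j => ?_) N
  have := norm_fCoeff_le_of_holomorphic hr hrδ hF
    (fun x => by rw [← Complex.ofReal_add, hreal, hreal]; exact hper x) hB j
  rw [funext hreal] at this
  convert this using 3
  ring

/-- For an analytic uniformly expanding degree-`β` circle map (analytic
distortion condition (AD_δ) on the strip `|Im z| ≤ δ`), the Fourier--Galerkin truncation
error of the transfer operator decays exponentially: there are `C > 0` and `ζ ∈ (0,δ]` with
`‖Lφ - P_N(Lφ)‖_BV ≤ C N^{3/2} e^{-ζN} ‖φ‖_BV` for every trigonometric polynomial `φ` of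
degree at most `N`. -/
theorem truncation_error_analytic
    (β : ℕ) (hβ : 2 ≤ β) (lam δ : ℝ) (hlam : 1 < lam) (hδ : 0 < δ)
    (v : ℝ → ℝ) (V : ℂ → ℂ)
    (hlift : ∀ x : ℝ, v (x + 2 * Real.pi * β) = v x + 2 * Real.pi)
    (hd : ∀ x : ℝ, 0 < deriv v x ∧ deriv v x ≤ lam⁻¹)
    (hVv : ∀ x : ℝ, V x = (v x : ℂ))
    (hVhol : DifferentiableOn ℂ V {z : ℂ | |z.im| ≤ δ})
    (hV' : ∀ z : ℂ, |z.im| ≤ δ → deriv V z ≠ 0)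
    (C₁δ : ℝ)
    (hAD : ∀ z : ℂ, |z.im| ≤ δ → ‖deriv (deriv V) z‖ ≤ C₁δ * ‖deriv V z‖) :
    ∃ C > (0 : ℝ), ∃ ζ : ℝ, 0 < ζ ∧ ζ ≤ δ ∧
      ∀ N : ℕ, 1 ≤ N → ∀ φ : ℝ → ℂ, IsTrigPoly N φ →
        bvNorm (fun x => transferOp β v φ x - fTrunc N (transferOp β v φ) x) ≤
          C * ((N : ℝ) * Real.sqrt N) * Real.exp (-ζ * N) * bvNorm φ := by
  have hV : DifferentiableOn ℂ V {z : ℂ | |z.im| < δ} :=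
    hVhol.mono fun z (hz : |z.im| < δ) => hz.le
  have hC : 0 ≤ C₁δ := by
    have h0 : |(0 : ℂ).im| ≤ δ := by simpa using hδ.le
    exact nonneg_of_mul_nonneg_left ((norm_nonneg _).trans (hAD 0 h0))
      (norm_pos_iff.2 (hV' 0 h0))
  have hlog : 0 < Real.log lam := Real.log_pos hlam
  set r : ℝ := min (δ / 2) (Real.log lam / (C₁δ + 1)) with hrdef
  have hr : 0 < r := lt_min (half_pos hδ) (by positivity)
  have hrδ : r < δ := (min_le_left _ _).trans_lt (half_lt_self hδ)
  have hCr : C₁δ * r < Real.log lam := by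
    have h1 : (C₁δ + 1) * r ≤ Real.log lam := by
      rw [mul_comm, ← le_div_iff₀ (by positivity)]
      exact min_le_right _ _
    linarith
  set κ : ℝ := lam⁻¹ * Real.exp (C₁δ * r) with hκdef
  have hκ0 : 0 ≤ κ := by positivity
  have hκ1 : κ < 1 := by
    rw [hκdef, inv_mul_lt_one₀ (by positivity), ← Real.lt_log_iff_exp_lt (by positivity)]
    exact hCr
  have hκ : ∀ z : ℂ, |z.im| ≤ r → ‖deriv V z‖ ≤ κ := fun z hz =>
    norm_deriv_strip_le hrδ hC hV (fun z hz => hAD z hz.le) (fun x => by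
      rw [deriv_real_of_holomorphic_extension hVv
        (hV.differentiableAt ((isOpen_strip δ).mem_nhds (by simpa using hδ))),
        Complex.norm_real, Real.norm_of_nonneg (hd x).1.le]
      exact (hd x).2) hz
  set T := ∑' j : ℤ, (1 + 2 * Real.pi * |(j : ℝ)|) * Real.exp (-(r * (1 - κ) / 2) * |(j : ℝ)|)
    with hTdef
  have hT : 0 ≤ T := tsum_nonneg fun j => by positivity
  have hζ : 0 < r * (1 - κ) / 2 := half_pos (mul_pos hr (sub_pos.2 hκ1))
  refine ⟨3 * β * T + 1, by positivity, r * (1 - κ) / 2, hζ, by nlinarith, fun N hN φ hφ => ?_⟩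
  have hS : 0 ≤ bvNorm φ :=
    add_nonneg (Real.iSup_nonneg fun x => norm_nonneg _) ENNReal.toReal_nonneg
  have hN1 : (1 : ℝ) ≤ N := by exact_mod_cast hN
  have hsqrt : (1 : ℝ) ≤ Real.sqrt N := Real.one_le_sqrt.2 hN1
  have hNN : (N : ℝ) ≤ N * Real.sqrt N := le_mul_of_one_le_right (by positivity) hsqrt
  refine (bvNorm_transferOp_sub_fTrunc_le hr hrδ hκ1 hlift hVv hV hκ hφ).trans ?_
  rw [← hTdef]
  have hexp : Real.exp (N * (κ * r)) * Real.exp (-(r * (1 + κ) / 2) * N)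
      = Real.exp (-(r * (1 - κ) / 2) * N) := by
    rw [← Real.exp_add]; congr 1; ring
  calc _ = β * T * (2 * N + 1) *
        (Real.exp (N * (κ * r)) * Real.exp (-(r * (1 + κ) / 2) * N)) * bvNorm φ := by ring
    _ ≤ (3 * β * T + 1) * (N * Real.sqrt N) * Real.exp (-(r * (1 - κ) / 2) * N) * bvNorm φ := by
      rw [hexp]
      gcongr ?_ * _ * _
      have hβT : 0 ≤ β * T := by positivity
      calc β * T * (2 * N + 1) ≤ β * T * (3 * (N * Real.sqrt N)) := by
            gcongr; linarith
        _ ≤ (3 * β * T + 1) * (N * Real.sqrt N) := by nlinarith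
end
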